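/- arXiv:1905.13588 — 2 statements merged into one kernel-verified Lean document; each statement's English description precedes it below -/
import Mathlib

section
/- Let n ≥ 1, A, B ⊆ {1,…,n−1}, Q ⊆ {0,…,n−1}, and suppose Γ_n(A,B,Q) is properly given (i.e. a₁ ≢ ±a₂ mod n for all a₁, a₂ ∈ A and b₁ ≢ ±b₂ mod n for all b₁, b₂ ∈ B). If |A| > 2 or |B| > 2, then Γ_n(A,B,Q) is non-planar. -/
/-- The circulant graph `circ_n(S)`: vertices `ZMod n`, with `i` adjacent to `i + s` for `s ∈ S`. -/
def circGraph (n : ℕ) (S : Finset ℕ) : SimpleGraph (ZMod n) :=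
  SimpleGraph.fromRel (fun i j => ∃ s ∈ S, j = i + (s : ZMod n))

/-- The graph `Γ_n(A,B,Q)` with vertices `v_i = Sum.inl i`, `v'_i = Sum.inr i`, and edges
`(v_i, v_{i+a})` for `a ∈ A`, `(v'_i, v'_{i+b})` for `b ∈ B`, `(v_i, v'_{i+q})` for `q ∈ Q`. -/
def Gamma (n : ℕ) (A B Q : Finset ℕ) : SimpleGraph (ZMod n ⊕ ZMod n) :=
  SimpleGraph.fromRel (fun x y =>
    match x, y with
    | Sum.inl i, Sum.inl j => ∃ a ∈ A, j = i + (a : ZMod n)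
    | Sum.inr i, Sum.inr j => ∃ b ∈ B, j = i + (b : ZMod n)
    | Sum.inl i, Sum.inr j => ∃ q ∈ Q, j = i + (q : ZMod n)
    | Sum.inr _, Sum.inl _ => False)

/-- `H` is a minor of `G`: there are disjoint connected branch sets in `G`, one for each
vertex of `H`, such that adjacent vertices of `H` have adjacent branch sets. -/
def SimpleGraph.IsMinorOf {W V : Type*} (H : SimpleGraph W) (G : SimpleGraph V) : Prop :=
  ∃ f : V → Option W,
    (∀ w : W, (G.induce {v | f v = some w}).Connected) ∧
    (∀ w₁ w₂ : W, H.Adj w₁ w₂ →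
      ∃ v₁ v₂, f v₁ = some w₁ ∧ f v₂ = some w₂ ∧ G.Adj v₁ v₂)

/-- A graph is planar iff it has no `K₅` minor and no `K_{3,3}` minor (Wagner's theorem). -/
def SimpleGraph.Planar {V : Type*} (G : SimpleGraph V) : Prop :=
  ¬ (⊤ : SimpleGraph (Fin 5)).IsMinorOf G ∧
  ¬ (completeBipartiteGraph (Fin 3) (Fin 3)).IsMinorOf G

/-- `Γ_n(A,B,Q)` is properly given: `a₁ ≢ ±a₂ (mod n)` for distinct `a₁, a₂ ∈ A`,
and similarly for `B`. -/
def ProperlyGiven (n : ℕ) (A B : Finset ℕ) : Prop :=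
  (∀ a₁ ∈ A, ∀ a₂ ∈ A, a₁ ≠ a₂ →
    (a₁ : ZMod n) ≠ (a₂ : ZMod n) ∧ (a₁ : ZMod n) ≠ -(a₂ : ZMod n)) ∧
  (∀ b₁ ∈ B, ∀ b₂ ∈ B, b₁ ≠ b₂ →
    (b₁ : ZMod n) ≠ (b₂ : ZMod n) ∧ (b₁ : ZMod n) ≠ -(b₂ : ZMod n))

/-- `circ_n(S)` is properly given: `s ≢ ±t (mod n)` for distinct `s, t ∈ S`. -/
def ProperlyGivenS (n : ℕ) (S : Finset ℕ) : Prop :=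
  ∀ s ∈ S, ∀ t ∈ S, s ≠ t →
    (s : ZMod n) ≠ (t : ZMod n) ∧ (s : ZMod n) ≠ -(t : ZMod n)

/-- A permutation is regular of order `n`: all its cycles have length exactly `n`
(for `n = 1` this means the identity). -/
def IsRegularOfOrder {α : Type*} (f : Equiv.Perm α) (n : ℕ) : Prop :=
  f ^ n = 1 ∧ ∀ x : α, ∀ k : ℕ, 0 < k → k < n → (f ^ k) x ≠ x

namespace SimpleGraph

variable {V W : Type*}

/-- Vertex sets that are disjoint and joined by an edge. -/
def Linked (G : SimpleGraph V) (S T : Set V) : Prop :=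
  Disjoint S T ∧ ∃ x ∈ S, ∃ y ∈ T, G.Adj x y

theorem Linked.symm {G : SimpleGraph V} {S T : Set V} (h : G.Linked S T) : G.Linked T S := by
  obtain ⟨hd, x, hx, y, hy, hxy⟩ := h
  exact ⟨hd.symm, y, hy, x, hx, hxy.symm⟩

theorem isMinorOf_of_sets {H : SimpleGraph W} {G : SimpleGraph V} (s : W → Set V)
    (hconn : ∀ w, (G.induce (s w)).Connected)
    (hdisj : ∀ w₁ w₂, w₁ ≠ w₂ → Disjoint (s w₁) (s w₂))
    (hadj : ∀ w₁ w₂, H.Adj w₁ w₂ → ∃ x ∈ s w₁, ∃ y ∈ s w₂, G.Adj x y) :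
    H.IsMinorOf G := by
  classical
  let f : V → Option W := fun v => if h : ∃ w, v ∈ s w then some h.choose else none
  have hf : ∀ v w, f v = some w ↔ v ∈ s w := by
    intro v w
    constructor
    · intro h
      by_cases hv : ∃ w, v ∈ s w
      · simp only [f, dif_pos hv, Option.some.injEq] at h
        exact h ▸ hv.choose_spec
      · simp [f, dif_neg hv] at h
    · intro h
      have hv : ∃ w, v ∈ s w := ⟨w, h⟩
      simp only [f, dif_pos hv, Option.some.injEq]
      by_contra hne
      exact Set.disjoint_left.1 (hdisj _ _ hne) hv.choose_spec h
  refine ⟨f, fun w => ?_, fun w₁ w₂ h => ?_⟩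
  · have : {v | f v = some w} = s w := Set.ext fun v => hf v w
    rw [this]
    exact hconn w
  · obtain ⟨x, hx, y, hy, hxy⟩ := hadj w₁ w₂ h
    exact ⟨x, y, (hf _ _).2 hx, (hf _ _).2 hy, hxy⟩

theorem connected_induce_singleton (G : SimpleGraph V) (v : V) :
    (G.induce {v}).Connected := by
  rw [connected_iff]
  exact ⟨Preconnected.of_subsingleton, ⟨⟨v, rfl⟩⟩⟩

theorem IsContained.isMinorOf {H : SimpleGraph W} {G : SimpleGraph V} (h : H.IsContained G) :
    H.IsMinorOf G := by
  obtain ⟨φ⟩ := h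
  refine isMinorOf_of_sets (fun w => {φ w}) (fun w => connected_induce_singleton G _) ?_ ?_
  · intro w₁ w₂ hne
    simpa using fun h => hne (φ.injective h)
  · intro w₁ w₂ h
    exact ⟨_, rfl, _, rfl, φ.toHom.map_adj h⟩

theorem IsMinorOf.trans {U : Type*} {H : SimpleGraph U} {K : SimpleGraph W} {G : SimpleGraph V}
    (hHK : H.IsMinorOf K) (hKG : K.IsMinorOf G) : H.IsMinorOf G := by
  obtain ⟨g, hgc, hga⟩ := hHK
  obtain ⟨f, hfc, hfa⟩ := hKG
  have hb : ∀ {v w u}, f v = some w → g w = some u → (f v).bind g = some u := by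
    intro v w u h1 h2
    simp [h1, h2]
  refine ⟨fun v => (f v).bind g, fun u => ?_, fun u₁ u₂ h => ?_⟩
  · have hfib : ∀ (w : W) (hw : g w = some u) (x y : V) (hx : f x = some w) (hy : f y = some w),
        (G.induce {v | (f v).bind g = some u}).Reachable ⟨x, hb hx hw⟩ ⟨y, hb hy hw⟩ := by
      intro w hw x y hx hy
      have hle : {v | f v = some w} ≤ {v | (f v).bind g = some u} := fun v hv => hb hv hw
      exact ((hfc w).preconnected ⟨x, hx⟩ ⟨y, hy⟩).map (induceHomOfLE G hle).toHom
    have hwalk : ∀ (w w' : {w | g w = some u}), (K.induce {w | g w = some u}).Walk w w' →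
        ∀ (x y : V) (hx : f x = some w.1) (hy : f y = some w'.1),
        (G.induce {v | (f v).bind g = some u}).Reachable ⟨x, hb hx w.2⟩ ⟨y, hb hy w'.2⟩ := by
      intro w w' p
      induction p with
      | @nil w₀ => exact fun x y hx hy => hfib w₀.1 w₀.2 x y hx hy
      | @cons w₁ w₂ _ hadj _ ih =>
        intro x y hx hy
        obtain ⟨v₁, v₂, h1, h2, h12⟩ := hfa w₁.1 w₂.1 hadj
        refine (hfib _ w₁.2 x v₁ hx h1).trans (Reachable.trans (Adj.reachable ?_) (ih v₂ y h2 hy))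
        exact h12
    obtain ⟨⟨w, hw⟩⟩ := (hgc u).nonempty
    obtain ⟨⟨v, hv⟩⟩ := (hfc w).nonempty
    rw [connected_iff]
    refine ⟨?_, ⟨⟨v, hb hv hw⟩⟩⟩
    rintro ⟨x, hx⟩ ⟨y, hy⟩
    obtain ⟨wx, hx1, hx2⟩ := Option.bind_eq_some_iff.1 hx
    obtain ⟨wy, hy1, hy2⟩ := Option.bind_eq_some_iff.1 hy
    obtain ⟨p⟩ := (hgc u).preconnected ⟨wx, hx2⟩ ⟨wy, hy2⟩
    exact hwalk _ _ p x y hx1 hy1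
  · obtain ⟨w₁, w₂, h1, h2, h12⟩ := hga u₁ u₂ h
    obtain ⟨v₁, v₂, k1, k2, k12⟩ := hfa w₁ w₂ h12
    exact ⟨v₁, v₂, hb k1 h1, hb k2 h2, k12⟩

theorem Planar.of_isContained {H : SimpleGraph W} {G : SimpleGraph V} (hG : G.Planar)
    (h : H.IsContained G) : H.Planar :=
  ⟨fun h5 => hG.1 (h5.trans h.isMinorOf), fun h33 => hG.2 (h33.trans h.isMinorOf)⟩

theorem isMinorOf_K5 {G : SimpleGraph V} {s₀ s₁ s₂ s₃ s₄ : Set V}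
    (c₀ : (G.induce s₀).Connected) (c₁ : (G.induce s₁).Connected)
    (c₂ : (G.induce s₂).Connected) (c₃ : (G.induce s₃).Connected)
    (c₄ : (G.induce s₄).Connected)
    (h₀₁ : G.Linked s₀ s₁) (h₀₂ : G.Linked s₀ s₂) (h₀₃ : G.Linked s₀ s₃) (h₀₄ : G.Linked s₀ s₄)
    (h₁₂ : G.Linked s₁ s₂) (h₁₃ : G.Linked s₁ s₃) (h₁₄ : G.Linked s₁ s₄)
    (h₂₃ : G.Linked s₂ s₃) (h₂₄ : G.Linked s₂ s₄) (h₃₄ : G.Linked s₃ s₄) :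
    (⊤ : SimpleGraph (Fin 5)).IsMinorOf G := by
  have hl : ∀ i j : Fin 5, i ≠ j →
      G.Linked (![s₀, s₁, s₂, s₃, s₄] i) (![s₀, s₁, s₂, s₃, s₄] j) := by
    intro i j hij
    fin_cases i <;> fin_cases j <;>
      first
      | exact absurd rfl hij
      | assumption
      | (apply Linked.symm; assumption)
  refine isMinorOf_of_sets ![s₀, s₁, s₂, s₃, s₄] ?_ (fun i j h => (hl i j h).1)
    (fun i j h => (hl i j h).2)
  intro i
  fin_cases i <;> assumption

theorem isMinorOf_K33 {G : SimpleGraph V} {s₀ s₁ s₂ t₀ t₁ t₂ : Set V}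
    (c₀ : (G.induce s₀).Connected) (c₁ : (G.induce s₁).Connected)
    (c₂ : (G.induce s₂).Connected) (d₀ : (G.induce t₀).Connected)
    (d₁ : (G.induce t₁).Connected) (d₂ : (G.induce t₂).Connected)
    (hs₀₁ : Disjoint s₀ s₁) (hs₀₂ : Disjoint s₀ s₂) (hs₁₂ : Disjoint s₁ s₂)
    (ht₀₁ : Disjoint t₀ t₁) (ht₀₂ : Disjoint t₀ t₂) (ht₁₂ : Disjoint t₁ t₂)
    (h₀₀ : G.Linked s₀ t₀) (h₀₁ : G.Linked s₀ t₁) (h₀₂ : G.Linked s₀ t₂)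
    (h₁₀ : G.Linked s₁ t₀) (h₁₁ : G.Linked s₁ t₁) (h₁₂ : G.Linked s₁ t₂)
    (h₂₀ : G.Linked s₂ t₀) (h₂₁ : G.Linked s₂ t₁) (h₂₂ : G.Linked s₂ t₂) :
    (completeBipartiteGraph (Fin 3) (Fin 3)).IsMinorOf G := by
  have hs : ∀ i j : Fin 3, i ≠ j → Disjoint (![s₀, s₁, s₂] i) (![s₀, s₁, s₂] j) := by
    intro i j hij
    fin_cases i <;> fin_cases j <;>
      first
      | exact absurd rfl hij
      | assumption
      | (apply Disjoint.symm; assumption)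
  have ht : ∀ i j : Fin 3, i ≠ j → Disjoint (![t₀, t₁, t₂] i) (![t₀, t₁, t₂] j) := by
    intro i j hij
    fin_cases i <;> fin_cases j <;>
      first
      | exact absurd rfl hij
      | assumption
      | (apply Disjoint.symm; assumption)
  have hl : ∀ i j : Fin 3, G.Linked (![s₀, s₁, s₂] i) (![t₀, t₁, t₂] j) := by
    intro i j
    fin_cases i <;> fin_cases j <;> assumption
  refine isMinorOf_of_sets (Sum.elim ![s₀, s₁, s₂] ![t₀, t₁, t₂]) ?_ ?_ ?_
  · rintro (i | i) <;> fin_cases i <;> assumption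
  · rintro (i | i) (j | j) hij
    · exact hs i j fun h => hij (congrArg _ h)
    · exact (hl i j).1
    · exact (hl j i).1.symm
    · exact ht i j fun h => hij (congrArg _ h)
  · rintro (i | i) (j | j) hij
    · simp at hij
    · exact (hl i j).2
    · exact (hl j i).symm.2
    · simp at hij


open Classical in
theorem card_edgeFinset_of_eq_induce_compl_singleton [Fintype V] (G : SimpleGraph V) (v : V)
    (G' : SimpleGraph ({v}ᶜ : Set V)) (hG' : G' = G.induce {v}ᶜ) :
    G'.edgeFinset.card = G.edgeFinset.card - G.degree v := by
  subst hG'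
  have h1 := G.card_edgeFinset_deleteIncidenceSet v
  have h2 := G.card_edgeFinset_induce_compl_singleton v
  rw [h1] at h2
  convert h2

open Classical in
theorem exists_contraction [Fintype V] (G : SimpleGraph V) {u v : V} (huv : G.Adj u v) :
    ∃ G' : SimpleGraph ({v}ᶜ : Set V), G'.IsMinorOf G ∧
      G.edgeFinset.card ≤ G'.edgeFinset.card + (G.neighborFinset u ∩ G.neighborFinset v).card + 1 := by
  obtain ⟨K, hK⟩ : ∃ K : SimpleGraph V, ∀ x y, K.Adj x y ↔
      G.Adj x y ∨ (x ≠ y ∧ ((x = u ∧ G.Adj v y) ∨ (y = u ∧ G.Adj v x))) :=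
    ⟨G ⊔ fromRel (fun x y => x = u ∧ G.Adj v y), by simp⟩
  refine ⟨K.induce {v}ᶜ, ?_, ?_⟩
  · refine isMinorOf_of_sets (fun w => {x | x = w ∨ (x = v ∧ w = u)}) ?_ ?_ ?_
    · rintro ⟨w, hw⟩
      by_cases hwu : w = u
      · subst hwu
        have : {x | x = w ∨ (x = v ∧ w = w)} = ({w, v} : Set V) := by
          ext x; simp
        exact this ▸ induce_pair_connected_of_adj huv
      · have : {x | x = w ∨ (x = v ∧ w = u)} = ({w} : Set V) := by
          ext x; simp [hwu]
        exact this ▸ connected_induce_singleton G w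
    · rintro ⟨w₁, hw₁⟩ ⟨w₂, hw₂⟩ hne
      rw [Set.disjoint_left]
      simp only [Set.mem_compl_iff, Set.mem_singleton_iff, ne_eq, Subtype.mk.injEq] at hw₁ hw₂ hne
      simp only [Set.mem_ofPred_eq]
      grind
    · rintro ⟨w₁, hw₁⟩ ⟨w₂, hw₂⟩ h
      rw [comap_adj, hK] at h
      rcases h with h | ⟨-, ⟨h1, h2⟩ | ⟨h1, h2⟩⟩
      · exact ⟨w₁, Or.inl rfl, w₂, Or.inl rfl, h⟩
      · exact ⟨v, Or.inr ⟨rfl, h1⟩, w₂, Or.inl rfl, h2⟩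
      · exact ⟨w₁, Or.inl rfl, v, Or.inr ⟨rfl, h1⟩, h2.symm⟩
  · have hvu : u ≠ v := huv.ne
    have hdeg : K.degree v = G.degree v := by
      rw [← card_neighborFinset_eq_degree, ← card_neighborFinset_eq_degree]
      congr 1
      ext y
      simp only [mem_neighborFinset, hK]
      grind [SimpleGraph.irrefl]
    have h1 := card_edgeFinset_of_eq_induce_compl_singleton K v _ rfl
    rw [hdeg] at h1
    let D : Finset V := (G.neighborFinset v \ (G.neighborFinset u ∩ G.neighborFinset v)).erase u
    have hmemD : ∀ y, y ∈ D ↔ y ≠ u ∧ G.Adj v y ∧ ¬ G.Adj u y := by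
      intro y
      simp only [D, Finset.mem_erase, Finset.mem_sdiff, Finset.mem_inter, mem_neighborFinset]
      tauto
    have hD : D.card + (G.neighborFinset u ∩ G.neighborFinset v).card + 1 = G.degree v := by
      have hu : u ∈ G.neighborFinset v \ (G.neighborFinset u ∩ G.neighborFinset v) := by
        simp [huv.symm]
      have := Finset.card_erase_add_one hu
      have h3 := Finset.card_sdiff_add_card_eq_card
        (Finset.inter_subset_right (s₁ := G.neighborFinset u) (s₂ := G.neighborFinset v))
      rw [card_neighborFinset_eq_degree] at h3
      grind
    have hinj : (D.image fun y => s(u, y)).card = D.card :=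
      Finset.card_image_of_injective _ fun a b h => Sym2.congr_right.1 h
    have hdis : Disjoint G.edgeFinset (D.image fun y => s(u, y)) := by
      rw [Finset.disjoint_left]
      intro e he hi
      obtain ⟨y, hy, rfl⟩ := Finset.mem_image.1 hi
      exact ((hmemD y).1 hy).2.2 (by simpa using he)
    have hsub : G.edgeFinset ∪ (D.image fun y => s(u, y)) ⊆ K.edgeFinset := by
      refine Finset.union_subset (edgeFinset_mono fun x y h => (hK x y).2 (Or.inl h)) ?_
      intro e hi
      obtain ⟨y, hy, rfl⟩ := Finset.mem_image.1 hi
      obtain ⟨h1, h2, -⟩ := (hmemD y).1 hy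
      rw [mem_edgeFinset, mem_edgeSet, hK]
      exact Or.inr ⟨h1.symm, Or.inl ⟨rfl, h2⟩⟩
    have hcard := Finset.card_le_card hsub
    rw [Finset.card_union_of_disjoint hdis, hinj] at hcard
    omega

open Classical in
/-- A vertex with at most five neighbours, each of which has at least three common neighbours
with it, gives a `K₅` minor. -/
theorem isMinorOf_K5_of_dense_neighborhood [Fintype V] (G : SimpleGraph V) {v u₀ : V}
    (hu₀ : G.Adj v u₀) (hdeg : G.degree v ≤ 5)
    (h3 : ∀ u, G.Adj v u → 3 ≤ (G.neighborFinset u ∩ G.neighborFinset v).card) :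
    (⊤ : SimpleGraph (Fin 5)).IsMinorOf G := by
  have hs := connected_induce_singleton G
  have link : ∀ x y, G.Adj x y → G.Linked {x} {y} := fun x y h =>
    ⟨by simpa using h.ne, x, rfl, y, rfl, h⟩
  rw [← card_neighborFinset_eq_degree] at hdeg
  have hNu : ∀ u, G.Adj v u →
      G.neighborFinset u ∩ G.neighborFinset v ⊆ (G.neighborFinset v).erase u := by
    intro u hu x
    simp only [Finset.mem_inter, mem_neighborFinset, Finset.mem_erase]
    exact fun h => ⟨h.1.ne', h.2⟩
  by_cases hcl : ∀ x y, G.Adj v x → G.Adj v y → x ≠ y → G.Adj x y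
  · obtain ⟨a, b, c, ha, hb, hc, hab, hac, hbc⟩ := Finset.two_lt_card_iff.1 (h3 u₀ hu₀)
    simp only [Finset.mem_inter, mem_neighborFinset] at ha hb hc
    exact isMinorOf_K5 (hs v) (hs u₀) (hs a) (hs b) (hs c) (link _ _ hu₀) (link _ _ ha.2)
      (link _ _ hb.2) (link _ _ hc.2) (link _ _ ha.1) (link _ _ hb.1) (link _ _ hc.1)
      (link _ _ (hcl _ _ ha.2 hb.2 hab)) (link _ _ (hcl _ _ ha.2 hc.2 hac))
      (link _ _ (hcl _ _ hb.2 hc.2 hbc))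
  · push Not at hcl
    obtain ⟨p, q, hp, hq, hpq, hnadj⟩ := hcl
    set R := ((G.neighborFinset v).erase p).erase q with hRdef
    have hRcard : R.card ≤ 3 := by
      have h1 := Finset.card_erase_add_one ((G.mem_neighborFinset v p).2 hp)
      have h2 := Finset.card_erase_add_one (a := q) (s := (G.neighborFinset v).erase p)
        (by simp [hpq.symm, hq])
      rw [← hRdef] at h2
      omega
    have hsubp : G.neighborFinset p ∩ G.neighborFinset v ⊆ R := by
      intro x
      simp only [R, Finset.mem_inter, mem_neighborFinset, Finset.mem_erase]
      rintro ⟨h1, h2⟩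
      exact ⟨fun h => hnadj (h ▸ h1), h1.ne', h2⟩
    have hsubq : G.neighborFinset q ∩ G.neighborFinset v ⊆ R := by
      intro x
      simp only [R, Finset.mem_inter, mem_neighborFinset, Finset.mem_erase]
      rintro ⟨h1, h2⟩
      exact ⟨h1.ne', fun h => hnadj (h ▸ h1).symm, h2⟩
    have heqp := Finset.eq_of_subset_of_card_le hsubp (hRcard.trans (h3 p hp))
    have heqq := Finset.eq_of_subset_of_card_le hsubq (hRcard.trans (h3 q hq))
    have hRv : ∀ x ∈ R, G.Adj v x := fun x hx => by
      rw [← heqp] at hx; simpa using (Finset.mem_inter.1 hx).2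
    have hRp : ∀ x ∈ R, G.Adj p x := fun x hx => by
      rw [← heqp] at hx; simpa using (Finset.mem_inter.1 hx).1
    have hRq : ∀ x ∈ R, G.Adj q x := fun x hx => by
      rw [← heqq] at hx; simpa using (Finset.mem_inter.1 hx).1
    have hRcard' : R.card = 3 := le_antisymm hRcard (heqp ▸ h3 p hp)
    have key : ∀ x y z, x ∈ R → y ∈ R → z ∈ R → x ≠ y → x ≠ z → G.Adj y z →
        (⊤ : SimpleGraph (Fin 5)).IsMinorOf G := by
      intro x y z hx hy hz hxy hxz hyz
      have lp : ∀ w, G.Adj p w → x ≠ w → G.Linked {p, x} {w} := fun w hw hne =>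
        ⟨by simp [hw.ne', hne.symm], p, by simp, w, rfl, hw⟩
      exact isMinorOf_K5 (induce_pair_connected_of_adj (hRp x hx)) (hs v) (hs q) (hs y) (hs z)
        (lp v hp.symm (hRv x hx).ne')
        ⟨by simp [hpq.symm, (hRq x hx).ne], x, by simp, q, rfl, (hRq x hx).symm⟩
        (lp y (hRp y hy) hxy) (lp z (hRp z hz) hxz) (link _ _ hq) (link _ _ (hRv y hy))
        (link _ _ (hRv z hz)) (link _ _ (hRq y hy)) (link _ _ (hRq z hz)) (link _ _ hyz)
    obtain ⟨x, y, z, hxy, hxz, hyz, hR⟩ := Finset.card_eq_three.1 hRcard'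
    have hx : x ∈ R := by simp [hR]
    have hy : y ∈ R := by simp [hR]
    have hz : z ∈ R := by simp [hR]
    by_cases h1 : G.Adj x y
    · exact key z x y hz hx hy hxz.symm hyz.symm h1
    by_cases h2 : G.Adj x z
    · exact key y x z hy hx hz hxy.symm hyz h2
    exfalso
    have hsub : G.neighborFinset x ∩ G.neighborFinset v ⊆ {p, q} := by
      intro w hw
      simp only [Finset.mem_inter, mem_neighborFinset] at hw
      by_contra hne
      have hwR : w ∈ R := by
        simp only [Finset.mem_insert, Finset.mem_singleton, not_or] at hne
        simp [R, hne.1, hne.2, hw.2]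
      rw [hR] at hwR
      simp only [Finset.mem_insert, Finset.mem_singleton] at hwR
      rcases hwR with rfl | rfl | rfl
      · exact hw.1.ne rfl
      · exact h1 hw.1
      · exact h2 hw.1
    have := (h3 x (hRv x hx)).trans ((Finset.card_le_card hsub).trans Finset.card_le_two)
    omega

open Classical in
/-- **Mader's theorem**: a graph with `n ≥ 3` vertices and at least `3n - 5` edges
has a `K₅` minor. -/
theorem isMinorOf_K5_of_three_mul_card_le (n : ℕ) (hn : 3 ≤ n) :
    ∀ {V : Type*} [Fintype V] (G : SimpleGraph V), Fintype.card V = n →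
      3 * n ≤ G.edgeFinset.card + 5 → (⊤ : SimpleGraph (Fin 5)).IsMinorOf G := by
  induction n, hn using Nat.le_induction with
  | base =>
    intro V _ G hV hG
    have := G.card_edgeFinset_le_card_choose_two
    rw [hV, show Nat.choose 3 2 = 3 from rfl] at this
    omega
  | succ n hn ih =>
    intro V _ G₀ hV hG₀
    obtain ⟨T, hT, hTcard⟩ := Finset.exists_subset_card_eq
      (show 3 * (n + 1) - 5 ≤ G₀.edgeFinset.card by omega)
    obtain ⟨G, hadj⟩ : ∃ G : SimpleGraph V, ∀ x y, G.Adj x y ↔ s(x, y) ∈ T ∧ x ≠ y :=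
      ⟨fromEdgeSet (T : Set (Sym2 V)), by simp⟩
    have hG : G.edgeFinset = T := by
      ext e
      induction e with
      | h x y =>
        rw [mem_edgeFinset, mem_edgeSet, hadj, and_iff_left_iff_imp]
        exact fun h => Adj.ne (by simpa using hT h)
    have hle : G ≤ G₀ := edgeFinset_subset_edgeFinset.1 (hG ▸ hT)
    have hcard : G.edgeFinset.card = 3 * (n + 1) - 5 := hG ▸ hTcard
    refine IsMinorOf.trans ?_ (IsContained.of_le hle).isMinorOf
    have hcardv : ∀ v : V, Fintype.card ({v}ᶜ : Set V) = n := fun v => by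
      rw [Fintype.card_compl_set]; simp [hV]
    obtain ⟨v, hv⟩ : ∃ v, G.degree v ≤ 5 := by
      by_contra! hlt
      have h1 : Finset.univ.card • 6 ≤ ∑ v, G.degree v :=
        Finset.card_nsmul_le_sum _ _ _ fun v _ => hlt v
      rw [G.sum_degrees_eq_twice_card_edges, Finset.card_univ, hV, hcard, smul_eq_mul] at h1
      omega
    by_cases h0 : ∃ u₀, G.Adj v u₀
    · obtain ⟨u₀, hu₀⟩ := h0
      by_cases h3 : ∀ u, G.Adj v u → 3 ≤ (G.neighborFinset u ∩ G.neighborFinset v).card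
      · exact isMinorOf_K5_of_dense_neighborhood G hu₀ hv h3
      · push Not at h3
        obtain ⟨u, hu, hu3⟩ := h3
        obtain ⟨G', hG', hc⟩ := G.exists_contraction hu.symm
        exact (ih G' (hcardv v) (by omega)).trans hG'
    · refine (ih (G.induce {v}ᶜ) (hcardv v) ?_).trans
        (IsContained.isMinorOf ⟨Copy.induce G {v}ᶜ⟩)
      have hd : G.degree v = 0 := by
        rw [← card_neighborFinset_eq_degree, Finset.card_eq_zero, Finset.eq_empty_iff_forall_notMem]
        exact fun u hu => h0 ⟨u, by simpa using hu⟩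
      have h1 := card_edgeFinset_of_eq_induce_compl_singleton G v _ rfl
      omega

theorem connected_induce_image_Icc {G : SimpleGraph V} {e : ℕ → V}
    (he : ∀ i, G.Adj (e i) (e (i + 1))) {p q : ℕ} (hpq : p ≤ q) :
    (G.induce (e '' Set.Icc p q)).Connected := by
  induction q, hpq using Nat.le_induction with
  | base =>
    rw [Set.Icc_self, Set.image_singleton]
    exact connected_induce_singleton G _
  | succ q hpq ih =>
    have hunion : e '' Set.Icc p (q + 1) = e '' Set.Icc p q ∪ {e q, e (q + 1)} := by
      rw [← Set.image_pair, ← Set.image_union]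
      congr 1
      ext i
      simp only [Set.mem_Icc, Set.mem_union, Set.mem_insert_iff, Set.mem_singleton_iff]
      omega
    rw [hunion]
    exact induce_union_connected ih.preconnected
      (induce_pair_connected_of_adj (he q)).preconnected
      ⟨e q, ⟨q, ⟨hpq, le_rfl⟩, rfl⟩, by simp⟩

theorem disjoint_image_Icc {e : ℕ → V} {m p q p' q' : ℕ} (hinj : Set.InjOn e (Set.Iio m))
    (hq : q < p') (hq' : q' < m) : Disjoint (e '' Set.Icc p q) (e '' Set.Icc p' q') := by
  rw [Set.disjoint_left]
  rintro _ ⟨i, hi, rfl⟩ ⟨j, hj, hij⟩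
  simp only [Set.mem_Icc] at hi hj
  have := hinj (Set.mem_Iio.2 (by omega)) (Set.mem_Iio.2 (by omega)) hij
  omega

theorem linked_image_Icc {G : SimpleGraph V} {e : ℕ → V} {m p q p' q' : ℕ}
    (hinj : Set.InjOn e (Set.Iio m)) (i j : ℕ) (hadj : G.Adj (e i) (e j))
    (h : (p ≤ i ∧ i ≤ q) ∧ (p' ≤ j ∧ j ≤ q') ∧ q < p' ∧ q' < m) :
    G.Linked (e '' Set.Icc p q) (e '' Set.Icc p' q') :=
  ⟨disjoint_image_Icc hinj h.2.2.1 h.2.2.2, e i, ⟨i, h.1, rfl⟩, e j, ⟨j, h.2.1, rfl⟩, hadj⟩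

/-- A cycle of even length at least six together with all its long diagonals has
a `K₃,₃` minor. -/
theorem isMinorOf_K33_of_antipodal_chords {G : SimpleGraph V} {e : ℕ → V} {h : ℕ} (hh : 3 ≤ h)
    (he : ∀ i, G.Adj (e i) (e (i + 1))) (hinj : Set.InjOn e (Set.Iio (2 * h)))
    (hclose : G.Adj (e 0) (e (2 * h - 1))) (hchord : ∀ i, G.Adj (e i) (e (i + h))) :
    (completeBipartiteGraph (Fin 3) (Fin 3)).IsMinorOf G := by
  have conn : ∀ {p q}, p ≤ q → (G.induce (e '' Set.Icc p q)).Connected :=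
    connected_induce_image_Icc he
  refine isMinorOf_K33 (s₀ := e '' Set.Icc 0 0) (s₁ := e '' Set.Icc 2 (h - 1))
    (s₂ := e '' Set.Icc (h + 1) (h + 1)) (t₀ := e '' Set.Icc 1 1) (t₁ := e '' Set.Icc h h)
    (t₂ := e '' Set.Icc (h + 2) (2 * h - 1)) (conn (by omega)) (conn (by omega)) (conn (by omega))
    (conn (by omega)) (conn (by omega)) (conn (by omega)) ?_ ?_ ?_ ?_ ?_ ?_
    ?_ ?_ ?_ ?_ ?_ ?_ ?_ ?_ ?_
  iterate 6 exact disjoint_image_Icc hinj (by omega) (by omega)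
  · exact linked_image_Icc hinj 0 1 (he 0) (by omega)
  · exact linked_image_Icc hinj 0 h (by simpa using hchord 0) (by omega)
  · exact linked_image_Icc hinj 0 (2 * h - 1) hclose (by omega)
  · exact (linked_image_Icc hinj 1 2 (he 1) (by omega)).symm
  · refine linked_image_Icc hinj (h - 1) h ?_ (by omega)
    have := he (h - 1)
    rwa [Nat.sub_add_cancel (by omega)] at this
  · exact linked_image_Icc hinj 2 (h + 2) (by simpa [add_comm] using hchord 2) (by omega)
  · exact (linked_image_Icc hinj 1 (h + 1) (by simpa [add_comm] using hchord 1) (by omega)).symm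
  · exact (linked_image_Icc hinj h (h + 1) (he h) (by omega)).symm
  · exact linked_image_Icc hinj (h + 1) (h + 2) (he (h + 1)) (by omega)

section Cayley

variable {M : Type*} [AddCommGroup M]

theorem isMinorOf_K5_of_three_generators [Fintype M] {G : SimpleGraph M} {a b c : M}
    (ha : ∀ x, G.Adj x (x + a)) (hb : ∀ x, G.Adj x (x + b)) (hc : ∀ x, G.Adj x (x + c))
    (haa : a ≠ -a) (hbb : b ≠ -b) (hcc : c ≠ -c) (hab : a ≠ b) (hab' : a ≠ -b)
    (hac : a ≠ c) (hac' : a ≠ -c) (hbc : b ≠ c) (hbc' : b ≠ -c) :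
    (⊤ : SimpleGraph (Fin 5)).IsMinorOf G := by
  classical
  let S : Finset M := {a, -a, b, -b, c, -c}
  have hS : S.card = 6 := by
    have hba := hab'.symm
    have hca := hac'.symm
    have hcb := hbc'.symm
    have h1 : -a ≠ b := fun h => hab' (by rw [← h, neg_neg])
    have h2 : -a ≠ c := fun h => hac' (by rw [← h, neg_neg])
    have h3 : -b ≠ c := fun h => hbc' (by rw [← h, neg_neg])
    simp only [S]
    repeat rw [Finset.card_insert_of_notMem (by simp [*])]
    simp
  have hdeg : ∀ x, 6 ≤ G.degree x := by
    intro x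
    rw [← card_neighborFinset_eq_degree, ← hS, ← Finset.card_image_of_injective S
      (add_right_injective x)]
    refine Finset.card_le_card fun y hy => ?_
    obtain ⟨s, hs, rfl⟩ := Finset.mem_image.1 hy
    rw [mem_neighborFinset]
    have hneg : ∀ {t : M}, (∀ x, G.Adj x (x + t)) → G.Adj x (x + -t) := fun {t} ht => by
      simpa using (ht (x + -t)).symm
    simp only [S, Finset.mem_insert, Finset.mem_singleton] at hs
    rcases hs with rfl | rfl | rfl | rfl | rfl | rfl
    exacts [ha x, hneg ha, hb x, hneg hb, hc x, hneg hc]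
  have hcard : 6 ≤ Fintype.card M := hS ▸ Finset.card_le_univ S
  have hsum : Finset.univ.card • 6 ≤ ∑ v, G.degree v :=
    Finset.card_nsmul_le_sum _ _ _ fun v _ => hdeg v
  rw [G.sum_degrees_eq_twice_card_edges, Finset.card_univ, smul_eq_mul] at hsum
  refine isMinorOf_K5_of_three_mul_card_le (Fintype.card M) (by omega) G rfl ?_
  convert (show 3 * Fintype.card M ≤ G.edgeFinset.card + 5 by omega)

theorem adj_add_nsmul_succ {G : SimpleGraph M} {a : M} (ha : ∀ x, G.Adj x (x + a)) (x : M)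
    (i : ℕ) : G.Adj (x + i • a) (x + (i + 1) • a) := by
  rw [succ_nsmul, ← add_assoc]
  exact ha _

theorem injOn_nsmul_Iio_addOrderOf (a : M) :
    Set.InjOn (fun i : ℕ => 0 + i • a) (Set.Iio (addOrderOf a)) := by
  simpa only [zero_add] using nsmul_injOn_Iio_addOrderOf

theorem adj_nsmul_addOrderOf_sub_one {G : SimpleGraph M} {a : M} (ha : ∀ x, G.Adj x (x + a))
    (hpos : 0 < addOrderOf a) : G.Adj (0 + 0 • a) (0 + (addOrderOf a - 1) • a) := by
  have h := ha ((addOrderOf a - 1) • a)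
  rw [← succ_nsmul, Nat.sub_add_cancel hpos, addOrderOf_nsmul_eq_zero] at h
  simpa using h.symm

theorem three_le_addOrderOf [Finite M] {a : M} (haa : a + a ≠ 0) : 3 ≤ addOrderOf a := by
  have hpos := addOrderOf_pos a
  have h := addOrderOf_nsmul_eq_zero a
  by_contra! hlt
  interval_cases addOrderOf a
  · exact haa (by simp_all)
  · exact haa (by rwa [two_nsmul] at h)

theorem disjoint_image_add_nsmul {a x y : M} (hxy : y - x ∉ AddSubgroup.zmultiples a)
    (s t : Set ℕ) :
    Disjoint ((fun i : ℕ => x + i • a) '' s) ((fun i : ℕ => y + i • a) '' t) := by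
  rw [Set.disjoint_left]
  rintro _ ⟨i, -, rfl⟩ ⟨j, -, hij⟩
  refine hxy ?_
  have : y - x = i • a - j • a := by
    rw [sub_eq_sub_iff_add_eq_add, add_comm (i • a)]
    exact hij
  rw [this]
  exact sub_mem (AddSubgroup.nsmul_mem_zmultiples a i) (AddSubgroup.nsmul_mem_zmultiples a j)

theorem linked_image_add_nsmul {G : SimpleGraph M} {a t x y : M} {p q p' q' : ℕ}
    (ht : ∀ x, G.Adj x (x + t)) (hxy : y - x ∉ AddSubgroup.zmultiples a) (hyx : y = x + t)
    (h : p ≤ q ∧ p' ≤ p ∧ p ≤ q') :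
    G.Linked ((fun i : ℕ => x + i • a) '' Set.Icc p q)
      ((fun i : ℕ => y + i • a) '' Set.Icc p' q') := by
  refine ⟨disjoint_image_add_nsmul hxy _ _, x + p • a, ⟨p, ⟨le_rfl, h.1⟩, rfl⟩,
    y + p • a, ⟨p, h.2, rfl⟩, ?_⟩
  rw [hyx, add_right_comm]
  exact ht _

theorem isMinorOf_K33_or_of_involution [Finite M] {G : SimpleGraph M} {a c : M}
    (ha : ∀ x, G.Adj x (x + a)) (hc : ∀ x, G.Adj x (x + c))
    (hu : ∀ x : M, x + x = 0 → x ≠ 0 → x = c) (haa : a + a ≠ 0) :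
    (completeBipartiteGraph (Fin 3) (Fin 3)).IsMinorOf G ∨ Odd (addOrderOf a) ∨ a + a = c := by
  rcases Nat.even_or_odd (addOrderOf a) with ⟨h, hh⟩ | hodd
  · have h3 := three_le_addOrderOf haa
    have hhc : h • a = c := by
      refine hu _ ?_ ?_
      · rw [← add_nsmul, ← hh, addOrderOf_nsmul_eq_zero]
      · exact nsmul_ne_zero_of_lt_addOrderOf (by omega) (by omega)
    by_cases hh2 : h = 2
    · subst hh2
      exact Or.inr (Or.inr (by rwa [two_nsmul] at hhc))
    · left
      have hinj := injOn_nsmul_Iio_addOrderOf a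
      have hclose := adj_nsmul_addOrderOf_sub_one ha (by omega)
      rw [hh, ← two_mul] at hinj hclose
      refine isMinorOf_K33_of_antipodal_chords (by omega) (adj_add_nsmul_succ ha 0) hinj hclose ?_
      intro i
      rw [add_nsmul, hhc, ← add_assoc]
      exact hc _
  · exact Or.inr (Or.inl hodd)

theorem isMinorOf_K5_of_odd_order [Finite M] {G : SimpleGraph M} {a b c : M}
    (ha : ∀ x, G.Adj x (x + a)) (hb : ∀ x, G.Adj x (x + b)) (hc : ∀ x, G.Adj x (x + c))
    (hcc : c + c = 0) (hc0 : c ≠ 0) (haa : a + a ≠ 0) (hb0 : b ≠ 0) (hab : a ≠ b)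
    (hab' : a ≠ -b) (hodd : Odd (addOrderOf a)) (hb_odd : Odd (addOrderOf b) ∨ b + b = c) :
    (⊤ : SimpleGraph (Fin 5)).IsMinorOf G := by
  have h3 := three_le_addOrderOf haa
  have hinj := injOn_nsmul_Iio_addOrderOf a
  have hclose := adj_nsmul_addOrderOf_sub_one ha (by omega)
  have hstep := adj_add_nsmul_succ ha
  have hodd_smul : ∀ {k : ℕ}, Odd k → k • c = c := by
    rintro _ ⟨t, rfl⟩
    rw [succ_nsmul, mul_comm, mul_nsmul, two_nsmul, ← nsmul_add, hcc, nsmul_zero, zero_add]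
  have hcZ : c ∉ AddSubgroup.zmultiples a := by
    intro hmem
    obtain ⟨k, rfl⟩ := AddSubgroup.mem_zmultiples_iff.1 hmem
    refine hc0 ?_
    rw [← hodd_smul hodd, smul_comm, addOrderOf_nsmul_eq_zero, smul_zero]
  have conn : ∀ (x : M) {p q}, p ≤ q →
      (G.induce ((fun i : ℕ => x + i • a) '' Set.Icc p q)).Connected :=
    fun x => connected_induce_image_Icc (hstep x)
  set m := addOrderOf a
  have linkc : ∀ {p q : ℕ}, p ≤ q ∧ q < m → G.Linked ((fun i : ℕ => 0 + i • a) '' Set.Icc p q)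
      ((fun i : ℕ => c + i • a) '' Set.Icc 0 (m - 1)) := fun h =>
    linked_image_add_nsmul hc (by simpa using hcZ) (zero_add c).symm (by omega)
  by_cases hbZ : b ∈ AddSubgroup.zmultiples a
  · obtain ⟨j, hj, hja⟩ : ∃ j < m, j • a = b := by
      classical
      have := mem_zmultiples_iff_mem_range_addOrderOf.1 hbZ
      simpa using this
    have hj0 : j ≠ 0 := fun h => hb0 (by rw [← hja, h, zero_nsmul])
    have hj1 : j ≠ 1 := fun h => hab (by rw [← hja, h, one_nsmul])
    have hjm : j + 1 ≠ m := fun h => hab' (by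
      rw [eq_neg_iff_add_eq_zero, ← hja, ← succ_nsmul', h, addOrderOf_nsmul_eq_zero])
    refine isMinorOf_K5 (conn 0 (p := 0) (q := 0) (by omega))
      (conn 0 (p := 1) (q := j - 1) (by omega)) (conn 0 (p := j) (q := j) (by omega))
      (conn 0 (p := j + 1) (q := m - 1) (by omega)) (conn c (p := 0) (q := m - 1) (by omega))
      (linked_image_Icc hinj 0 1 (hstep 0 0) (by omega))
      (linked_image_Icc hinj 0 j ?_ (by omega))
      (linked_image_Icc hinj 0 (m - 1) hclose (by omega)) (linkc (by omega))
      (linked_image_Icc hinj (j - 1) j ?_ (by omega))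
      (linked_image_Icc hinj 1 (j + 1) ?_ (by omega)) (linkc (by omega))
      (linked_image_Icc hinj j (j + 1) (hstep 0 j) (by omega)) (linkc (by omega))
      (linkc (by omega))
    · simpa [hja] using hb 0
    · have := hstep 0 (j - 1)
      rwa [Nat.sub_add_cancel (by omega)] at this
    · simpa [succ_nsmul', hja] using hb a
  · have hbcZ : b + c ∉ AddSubgroup.zmultiples a := by
      intro hmem
      rcases hb_odd with h | h
      · refine hcZ ?_
        have := nsmul_mem hmem (addOrderOf b)
        rwa [nsmul_add, addOrderOf_nsmul_eq_zero, hodd_smul h, zero_add] at this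
      · refine hcZ ?_
        have := add_mem hmem hmem
        rwa [add_add_add_comm, h, hcc, add_zero] at this
    have hbcZ' : b - c ∉ AddSubgroup.zmultiples a := by
      rwa [sub_eq_add_neg, neg_eq_of_add_eq_zero_left hcc]
    have linkb : ∀ {p q : ℕ}, p ≤ q ∧ q < m →
        G.Linked ((fun i : ℕ => 0 + i • a) '' Set.Icc p q)
          ((fun i : ℕ => b + i • a) '' Set.Icc 0 (m - 1) ∪
            (fun i : ℕ => b + c + i • a) '' Set.Icc 0 (m - 1)) := by
      intro p q h
      obtain ⟨hd, x, hx, y, hy, hxy⟩ := linked_image_add_nsmul (p := p) (q := q) (p' := 0)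
        (q' := m - 1) hb (by simpa using hbZ) (zero_add b).symm (by omega)
      exact ⟨Set.disjoint_union_right.2 ⟨hd, disjoint_image_add_nsmul (by simpa using hbcZ) _ _⟩,
        x, hx, y, Or.inl hy, hxy⟩
    have linkbc : G.Linked ((fun i : ℕ => c + i • a) '' Set.Icc 0 (m - 1))
          ((fun i : ℕ => b + i • a) '' Set.Icc 0 (m - 1) ∪
            (fun i : ℕ => b + c + i • a) '' Set.Icc 0 (m - 1)) := by
      obtain ⟨hd, x, hx, y, hy, hxy⟩ := linked_image_add_nsmul (a := a) (x := c) (y := b + c)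
        (p := 0) (q := m - 1) (p' := 0) (q' := m - 1) hb (by simpa using hbZ) (add_comm b c)
        (by omega)
      exact ⟨Set.disjoint_union_right.2 ⟨disjoint_image_add_nsmul hbcZ' _ _, hd⟩,
        x, hx, y, Or.inr hy, hxy⟩
    refine isMinorOf_K5 (conn 0 (p := 0) (q := 0) (by omega))
      (conn 0 (p := 1) (q := 1) (by omega)) (conn 0 (p := 2) (q := m - 1) (by omega))
      (conn c (p := 0) (q := m - 1) (by omega))
      (connected_induce_union (conn b (Nat.zero_le (m - 1))).preconnected
        (conn (b + c) (Nat.zero_le (m - 1))).preconnected ⟨0, by simp, rfl⟩ ⟨0, by simp, rfl⟩ ?_)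
      (linked_image_Icc hinj 0 1 (hstep 0 0) (by omega))
      (linked_image_Icc hinj 0 (m - 1) hclose (by omega)) (linkc (by omega)) (linkb (by omega))
      (linked_image_Icc hinj 1 2 (hstep 0 1) (by omega)) (linkc (by omega)) (linkb (by omega))
      (linkc (by omega)) (linkb (by omega)) linkbc
    simpa using hc b

theorem not_planar_of_involution [Finite M] {G : SimpleGraph M} {a b c : M}
    (ha : ∀ x, G.Adj x (x + a)) (hb : ∀ x, G.Adj x (x + b)) (hc : ∀ x, G.Adj x (x + c))
    (hu : ∀ x : M, x + x = 0 → x ≠ 0 → x = c) (hcc : c + c = 0) (hc0 : c ≠ 0)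
    (ha0 : a ≠ 0) (hb0 : b ≠ 0) (hab : a ≠ b) (hab' : a ≠ -b) (hac : a ≠ c) (hbc : b ≠ c) :
    ¬ G.Planar := by
  intro hG
  have haa : a + a ≠ 0 := fun h => hac (hu a h ha0)
  have hbb : b + b ≠ 0 := fun h => hbc (hu b h hb0)
  rcases isMinorOf_K33_or_of_involution ha hc hu haa with h | h | h
  · exact hG.2 h
  · exact hG.1 (isMinorOf_K5_of_odd_order ha hb hc hcc hc0 haa hb0 hab hab' h
      ((isMinorOf_K33_or_of_involution hb hc hu hbb).resolve_left hG.2))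
  · rcases isMinorOf_K33_or_of_involution hb hc hu hbb with k | k | k
    · exact hG.2 k
    · exact hG.1 (isMinorOf_K5_of_odd_order hb ha hc hcc hc0 hbb ha0 hab.symm
        (fun e => hab' (by rw [e, neg_neg])) k (Or.inr h))
    · have hdiff : (a - b) + (a - b) = 0 := by
        rw [sub_add_sub_comm, h, k, sub_self]
      have hd := hu _ hdiff (sub_ne_zero.2 hab)
      refine hab' (eq_neg_of_add_eq_zero_left ?_)
      rw [← hcc]
      nth_rewrite 1 [← hd]
      rw [← k]
      abel

end Cayley

theorem eq_of_add_self_eq_zero {n : ℕ} [NeZero n] {x y : ZMod n} (hx : x + x = 0)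
    (hy : y + y = 0) (hx0 : x ≠ 0) (hy0 : y ≠ 0) : x = y := by
  have key : ∀ z : ZMod n, z + z = 0 → z ≠ 0 → 2 * z.val = n := by
    intro z hz hz0
    have hdvd : n ∣ z.val + z.val := by
      rw [← ZMod.natCast_eq_zero_iff]
      simpa using hz
    have hlt := ZMod.val_lt z
    have hpos : z.val ≠ 0 := by simpa using hz0
    obtain ⟨k, hk⟩ := hdvd
    have hk1 : k = 1 := by
      have : k < 2 := by
        by_contra! h
        have := Nat.mul_le_mul_left n h
        omega
      have : k ≠ 0 := by
        rintro rfl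
        omega
      omega
    rw [hk1] at hk
    omega
  refine ZMod.val_injective n ?_
  have h1 := key x hx hx0
  have h2 := key y hy hy0
  omega

theorem not_planar_of_three_generators {n : ℕ} [NeZero n] {G : SimpleGraph (ZMod n)}
    {a b c : ZMod n} (ha : ∀ x, G.Adj x (x + a)) (hb : ∀ x, G.Adj x (x + b))
    (hc : ∀ x, G.Adj x (x + c)) (hab : a ≠ b) (hab' : a ≠ -b) (hac : a ≠ c) (hac' : a ≠ -c)
    (hbc : b ≠ c) (hbc' : b ≠ -c) : ¬ G.Planar := by
  have ne_zero : ∀ {t : ZMod n}, (∀ x, G.Adj x (x + t)) → t ≠ 0 := fun ht h =>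
    (ht 0).ne (by simp [h])
  have ha0 := ne_zero ha
  have hb0 := ne_zero hb
  have hc0 := ne_zero hc
  have hneg : ∀ {s t : ZMod n}, s ≠ -t → t ≠ -s := fun h e => h (by rw [e, neg_neg])
  by_cases haa : a = -a
  · have haa' := eq_neg_iff_add_eq_zero.1 haa
    exact not_planar_of_involution hb hc ha
      (fun x hx hx0 => eq_of_add_self_eq_zero hx haa' hx0 ha0) haa' ha0 hb0 hc0 hbc hbc'
      hab.symm hac.symm
  by_cases hbb : b = -b
  · have hbb' := eq_neg_iff_add_eq_zero.1 hbb
    exact not_planar_of_involution ha hc hb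
      (fun x hx hx0 => eq_of_add_self_eq_zero hx hbb' hx0 hb0) hbb' hb0 ha0 hc0 hac hac'
      hab hbc.symm
  by_cases hcc : c = -c
  · have hcc' := eq_neg_iff_add_eq_zero.1 hcc
    exact not_planar_of_involution ha hb hc
      (fun x hx hx0 => eq_of_add_self_eq_zero hx hcc' hx0 hc0) hcc' hc0 ha0 hb0 hab hab'
      hac hbc
  exact fun hG => hG.1 (isMinorOf_K5_of_three_generators ha hb hc haa hbb hcc hab hab' hac hac'
    hbc hbc')

theorem not_planar_of_circulant_subgraph {n : ℕ} [NeZero n] {S : Finset ℕ} {G : SimpleGraph V}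
    (φ : ZMod n → V) (hφ : Function.Injective φ)
    (hadj : ∀ s ∈ S, ∀ x, G.Adj (φ x) (φ (x + s))) (hpg : ProperlyGivenS n S)
    (hS : 2 < S.card) : ¬ G.Planar := by
  intro hG
  obtain ⟨a, b, c, ha, hb, hc, hab, hac, hbc⟩ := Finset.two_lt_card_iff.1 hS
  obtain ⟨hab1, hab2⟩ := hpg a ha b hb hab
  obtain ⟨hac1, hac2⟩ := hpg a ha c hc hac
  obtain ⟨hbc1, hbc2⟩ := hpg b hb c hc hbc
  exact not_planar_of_three_generators (G := G.comap φ) (hadj a ha) (hadj b hb) (hadj c hc)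
    hab1 hab2 hac1 hac2 hbc1 hbc2
    (hG.of_isContained ⟨(Embedding.comap ⟨φ, hφ⟩ G).toCopy⟩)

end SimpleGraph

theorem stmt12 (n : ℕ) (hn : 1 ≤ n) (A B Q : Finset ℕ)
    (hA : A ⊆ Finset.Ico 1 n) (hB : B ⊆ Finset.Ico 1 n) (hQ : Q ⊆ Finset.range n)
    (hpg : ProperlyGiven n A B) (hcard : 2 < A.card ∨ 2 < B.card) :
    ¬ (Gamma n A B Q).Planar := by
  have : NeZero n := ⟨by omega⟩
  have hne : ∀ {S : Finset ℕ}, S ⊆ Finset.Ico 1 n → ∀ s ∈ S, ∀ x : ZMod n, x ≠ x + s := by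
    intro S hS s hs x h
    have hlt := Finset.mem_Ico.1 (hS hs)
    have h0 : (s : ZMod n) = 0 := by simpa using h
    have := Nat.le_of_dvd (by omega) ((ZMod.natCast_eq_zero_iff _ _).1 h0)
    omega
  rcases hcard with h | h
  · refine SimpleGraph.not_planar_of_circulant_subgraph Sum.inl Sum.inl_injective ?_ hpg.1 h
    intro a ha x
    exact (SimpleGraph.fromRel_adj _ _ _).2
      ⟨fun e => hne hA a ha x (Sum.inl_injective e), Or.inl ⟨a, ha, rfl⟩⟩
  · refine SimpleGraph.not_planar_of_circulant_subgraph Sum.inr Sum.inr_injective ?_ hpg.2 h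
    intro b hb x
    exact (SimpleGraph.fromRel_adj _ _ _).2
      ⟨fun e => hne hB b hb x (Sum.inr_injective e), Or.inl ⟨b, hb, rfl⟩⟩
end

section
/- Let A = B = ∅, n ≥ 5, and Q ⊆ {0,…,n−1} nonempty. Then Γ_n(∅,∅,Q) is connected and planar if and only if either (i) Q = {q, q+s} for some q with gcd(n,s) = 1, or (ii) Q = {q, q+s, q−s} for some q with n even and gcd(n,s) = 1. -/
/-- If a linear map kills only functions factoring through `β`, its codomain is large. -/
theorem card_le_add_of_ker_factors {X Y W : Type*} [Fintype X] [Fintype Y] [Fintype W]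
    (M : (X → ZMod 2) →ₗ[ZMod 2] (Y → ZMod 2)) (β : X → W)
    (h : ∀ ψ, M ψ = 0 → ∃ χ : W → ZMod 2, ψ = χ ∘ β) :
    Fintype.card X ≤ Fintype.card Y + Fintype.card W := by
  classical
  have hker : M.ker ≤ (LinearMap.funLeft (ZMod 2) (ZMod 2) β).range := by
    intro ψ hψ
    obtain ⟨χ, rfl⟩ := h ψ hψ
    exact ⟨χ, rfl⟩
  have h1 := LinearMap.finrank_range_add_finrank_ker M
  have h2 := Submodule.finrank_mono hker
  have h3 := LinearMap.finrank_range_le (LinearMap.funLeft (ZMod 2) (ZMod 2) β)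
  have h4 := Submodule.finrank_le M.range
  simp only [Module.finrank_fintype_fun_eq_card] at h1 h3 h4
  omega

/-- A multigraph with vertices `V`, edges `E`, and faces `F`, where the edge `e` joins `s e` to
`t e` and separates the faces `l e` and `r e`: face boundaries are even, the dual is connected,
and Euler's formula holds. -/
structure SphereMap {V E F : Type*} [Fintype V] [Fintype E] [Fintype F] [DecidableEq V]
    (s t : E → V) (l r : E → F) : Prop where
  even : ∀ (φ : F → ZMod 2) (v : V), ∑ e, (φ (l e) + φ (r e)) *
    ((if s e = v then 1 else 0) + (if t e = v then 1 else 0)) = 0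
  dual_connected : ∀ φ : F → ZMod 2, (∀ e, φ (l e) = φ (r e)) → ∀ f g, φ f = φ g
  euler : Fintype.card V + Fintype.card F = Fintype.card E + 2

namespace SphereMap

variable {V E F W ι : Type*} [Fintype V] [Fintype E] [Fintype F] [DecidableEq V]
  [Fintype W] [Fintype ι] {s t : E → V} {l r : E → F}

theorem sum_boundary (h : SphereMap s t l r) (φ : F → ZMod 2) (ψ : V → ZMod 2) :
    ∑ e, (φ (l e) + φ (r e)) * (ψ (s e) + ψ (t e)) = 0 := by
  have key : ∀ e, ψ (s e) + ψ (t e) =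
      ∑ v, ((if s e = v then 1 else 0) + (if t e = v then 1 else 0)) * ψ v := by
    intro e
    simp [add_mul, Finset.sum_add_distrib]
  simp_rw [key, Finset.mul_sum]
  rw [Finset.sum_comm]
  refine Finset.sum_eq_zero fun v _ => ?_
  simp_rw [← mul_assoc]
  rw [← Finset.sum_mul, h.even, zero_mul]

/-- The fibres of `β` have spanning forests: a set `T` of edges inside the fibres with at least
`|V| - |W|` elements such that each `e ∈ T` is the only edge of `T` crossing some cut. -/
theorem exists_forest (β : V → W)
    (hβ : ∀ ψ : V → ZMod 2, (∀ e, β (s e) = β (t e) → ψ (s e) = ψ (t e)) →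
      ∀ u v, β u = β v → ψ u = ψ v) :
    ∃ T : Finset E, (∀ e ∈ T, β (s e) = β (t e)) ∧
      Fintype.card V ≤ T.card + Fintype.card W ∧
      ∀ e ∈ T, ∃ ψ : V → ZMod 2, ψ (s e) ≠ ψ (t e) ∧
        ∀ e' ∈ T, e' ≠ e → ψ (s e') = ψ (t e') := by
  classical
  let P : Finset E → Prop := fun T => (∀ e ∈ T, β (s e) = β (t e)) ∧
    ∀ ψ : V → ZMod 2, (∀ e ∈ T, ψ (s e) = ψ (t e)) → ∀ u v, β u = β v → ψ u = ψ v
  have hP : P (Finset.univ.filter fun e => β (s e) = β (t e)) := by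
    refine ⟨by simp, fun ψ hψ => hβ ψ fun e he => hψ e (by simpa using he)⟩
  obtain ⟨T, -, hT⟩ := exists_minimal_le_of_wellFoundedLT P _ hP
  refine ⟨T, hT.prop.1, ?_, ?_⟩
  · have := card_le_add_of_ker_factors (X := V) (Y := T) (W := W)
      { toFun := fun ψ e => ψ (s e) + ψ (t e)
        map_add' := by intros; ext; simp; ring
        map_smul' := by intros; ext; simp; ring } β ?_
    · simpa using this
    intro ψ hψ
    have hc : ∀ u v, β u = β v → ψ u = ψ v := by
      refine hT.prop.2 ψ fun e he => ?_
      have := congrFun hψ ⟨e, he⟩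
      exact CharTwo.add_eq_zero.1 this
    exact ((Function.factorsThrough_iff (g := ψ) (f := β)).1 fun u v huv => hc u v huv)
  · intro e he
    by_contra! hcon
    have : P (T.erase e) := by
      refine ⟨fun e' he' => hT.prop.1 e' (Finset.mem_of_mem_erase he'), fun ψ hψ => ?_⟩
      have h' : ∀ e' ∈ T, e' ≠ e → ψ (s e') = ψ (t e') :=
        fun e' he' hne => hψ e' (Finset.mem_erase.2 ⟨hne, he'⟩)
      refine hT.prop.2 ψ fun e' he' => ?_
      by_cases hee : e' = e
      · subst hee
        by_contra hne
        obtain ⟨e'', h1, h2, h3⟩ := hcon ψ hne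
        exact h3 (h' e'' h1 h2)
      · exact h' e' he' hee
    have := hT.le_of_le this (Finset.erase_subset e T) he
    simp at this

/-- A contraction of a sphere map onto the edges `c i` inherits a face structure. -/
theorem exists_faces (h : SphereMap s t l r) (β : V → W)
    (hβ : ∀ ψ : V → ZMod 2, (∀ e, β (s e) = β (t e) → ψ (s e) = ψ (t e)) →
      ∀ u v, β u = β v → ψ u = ψ v)
    (c : ι → E) (hc : Function.Injective c) (hcβ : ∀ i, β (s (c i)) ≠ β (t (c i)))
    (hcard : Fintype.card W ≤ Fintype.card ι) :
    ∃ (P : Type) (_ : Fintype P) (_ : DecidableEq P) (L R : ι → P),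
      Fintype.card ι + 2 ≤ Fintype.card P + Fintype.card W ∧
      ∀ p, (∃ i, (if L i = p then (1 : ZMod 2) else 0) + (if R i = p then 1 else 0) ≠ 0) ∧
        ∀ χ : W → ZMod 2, ∑ i, ((if L i = p then (1 : ZMod 2) else 0) + (if R i = p then 1 else 0))
          * (χ (β (s (c i))) + χ (β (t (c i)))) = 0 := by
  classical
  obtain ⟨T, hTin, hTcard, hTcut⟩ := exists_forest (s := s) (t := t) β hβ
  let C : Finset E := Finset.univ.image c
  have hdisj : Disjoint T C := by
    rw [Finset.disjoint_left]
    intro e he hec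
    obtain ⟨i, -, rfl⟩ := Finset.mem_image.1 hec
    exact hcβ i (hTin _ he)
  let D : Finset E := (T ∪ C)ᶜ
  have hDcard : D.card + T.card + Fintype.card ι = Fintype.card E := by
    have h1 := Finset.card_compl_add_card (T ∪ C)
    rw [Finset.card_union_of_disjoint hdisj, Finset.card_image_of_injective _ hc,
      Finset.card_univ] at h1
    show ((T ∪ C)ᶜ).card + _ + _ = _
    omega
  let st : Setoid F :=
    { r := fun f g => ∀ φ : F → ZMod 2, (∀ e ∈ D, φ (l e) = φ (r e)) → φ f = φ g
      iseqv := ⟨fun _ _ _ => rfl, fun h φ hφ => (h φ hφ).symm,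
        fun h h' φ hφ => (h φ hφ).trans (h' φ hφ)⟩ }
  have hP : Fintype.card F ≤ D.card + Fintype.card (Quotient st) := by
    have := card_le_add_of_ker_factors (X := F) (Y := D) (W := Quotient st)
      { toFun := fun ψ e => ψ (l e) + ψ (r e)
        map_add' := by intros; ext; simp; ring
        map_smul' := by intros; ext; simp; ring } (Quotient.mk st) ?_
    · simpa using this
    intro ψ hψ
    have hc : ∀ e ∈ D, ψ (l e) = ψ (r e) := by
      intro e he
      exact CharTwo.add_eq_zero.1 (congrFun hψ ⟨e, he⟩)
    exact ⟨Quotient.lift ψ fun a b hab => hab ψ hc, rfl⟩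
  have heuler := h.euler
  let k := Fintype.card (Quotient st)
  let en : Quotient st ≃ Fin k := Fintype.equivFin _
  let π : F → Fin k := fun f => en (Quotient.mk st f)
  have hπ : ∀ e ∈ D, π (l e) = π (r e) := by
    intro e he
    exact congrArg en (Quotient.sound fun φ hφ => hφ e he)
  have hk : Fintype.card ι + 2 ≤ k + Fintype.card W := by omega
  refine ⟨Fin k, inferInstance, inferInstance, fun i => π (l (c i)), fun i => π (r (c i)),
    by simpa using hk, fun p => ?_⟩
  let φ : F → ZMod 2 := fun f => if π f = p then 1 else 0
  have hφD : ∀ e, e ∉ T → e ∉ C → φ (l e) + φ (r e) = 0 := by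
    intro e h1 h2
    have : e ∈ D := by simp [D, h1, h2]
    simp only [φ, hπ e this]
    exact CharTwo.add_self_eq_zero _
  refine ⟨?_, fun χ => ?_⟩
  · by_contra! hno
    have hC : ∀ e ∈ C, φ (l e) + φ (r e) = 0 := by
      intro e he
      obtain ⟨i, -, rfl⟩ := Finset.mem_image.1 he
      exact hno i
    have hall : ∀ e, φ (l e) = φ (r e) := by
      intro e
      rw [← CharTwo.add_eq_zero]
      by_cases heT : e ∈ T
      · obtain ⟨ψ, hne, hψ⟩ := hTcut e heT
        have := h.sum_boundary φ ψ
        rw [Finset.sum_eq_single e] at this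
        · refine (mul_eq_zero.1 this).resolve_right fun h0 => hne (CharTwo.add_eq_zero.1 h0)
        · intro e' _ hee
          by_cases h1 : e' ∈ T
          · rw [hψ e' h1 hee, CharTwo.add_self_eq_zero, mul_zero]
          · by_cases h2 : e' ∈ C
            · rw [hC e' h2, zero_mul]
            · rw [hφD e' h1 h2, zero_mul]
        · simp
      · by_cases h2 : e ∈ C
        · exact hC e h2
        · exact hφD e heT h2
    have hconst := h.dual_connected φ hall
    have hsurj : ∀ p', ∃ f, π f = p' := by
      intro p'
      obtain ⟨f, hf⟩ := Quotient.exists_rep (en.symm p')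
      exact ⟨f, by simp [π, hf]⟩
    have : Nontrivial (Fin k) := by
      rw [← Fintype.one_lt_card_iff_nontrivial, Fintype.card_fin]
      omega
    obtain ⟨p', hp'⟩ := exists_ne p
    obtain ⟨f, hf⟩ := hsurj p
    obtain ⟨g, hg⟩ := hsurj p'
    have := hconst f g
    simp [φ, hf, hg, hp'] at this
  · have := h.sum_boundary φ (χ ∘ β)
    rw [← Finset.sum_subset (Finset.subset_univ C)] at this
    · rw [Finset.sum_image (fun _ _ _ _ hh => hc hh)] at this
      exact this
    · intro e _ he
      by_cases heT : e ∈ T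
      · simp only [Function.comp, hTin e heT, CharTwo.add_self_eq_zero, mul_zero]
      · rw [hφD e heT he, zero_mul]

end SphereMap

/-- A nonempty even set of edges of `K₅`, with edges listed lexicographically, has at least three
elements. -/
theorem three_le_of_even_K5 (z : Fin 10 → ZMod 2) (h0 : z 0 + z 1 + z 2 + z 3 = 0)
    (h1 : z 0 + z 4 + z 5 + z 6 = 0) (h2 : z 1 + z 4 + z 7 + z 8 = 0)
    (h3 : z 2 + z 5 + z 7 + z 9 = 0) (h : ∃ i, z i ≠ 0) : 3 ≤ ∑ i, (z i).val := by
  have key : ∀ a b c d e f : ZMod 2,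
      a.val + b.val + c.val + (a + b + c).val + d.val + e.val + (a + d + e).val + f.val +
        (b + d + f).val + (c + e + f).val = 0 ∨
      3 ≤ a.val + b.val + c.val + (a + b + c).val + d.val + e.val + (a + d + e).val + f.val +
        (b + d + f).val + (c + e + f).val := by
    decide
  have := key (z 0) (z 1) (z 2) (z 4) (z 5) (z 7)
  rw [CharTwo.add_eq_zero.1 h0, CharTwo.add_eq_zero.1 h1, CharTwo.add_eq_zero.1 h2,
    CharTwo.add_eq_zero.1 h3] at this
  have e : ∑ i, (z i).val = (z 0).val + (z 1).val + (z 2).val + (z 3).val + (z 4).val +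
      (z 5).val + (z 6).val + (z 7).val + (z 8).val + (z 9).val := by
    simp [Fin.sum_univ_succ, add_assoc]
  rw [← e] at this
  refine this.resolve_left fun hs => ?_
  obtain ⟨i, hi⟩ := h
  exact hi ((ZMod.val_eq_zero _).1 (Finset.sum_eq_zero_iff.1 hs i (Finset.mem_univ i)))

/-- A nonempty even set of edges of `K_{3,3}` has at least four elements. -/
theorem four_le_of_even_K33 (z : Fin 3 × Fin 3 → ZMod 2)
    (h1 : ∀ i, z (i, 0) + z (i, 1) + z (i, 2) = 0)
    (h2 : ∀ j, z (0, j) + z (1, j) + z (2, j) = 0) (h : ∃ i, z i ≠ 0) :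
    4 ≤ ∑ i, (z i).val := by
  have key : ∀ a b c d e f g h k : ZMod 2, a + b + c = 0 → d + e + f = 0 → g + h + k = 0 →
      a + d + g = 0 → b + e + h = 0 → c + f + k = 0 →
      (a.val + b.val + c.val + (d.val + e.val + f.val) + (g.val + h.val + k.val) = 0 ∨
      4 ≤ a.val + b.val + c.val + (d.val + e.val + f.val) + (g.val + h.val + k.val)) := by
    decide
  have := key _ _ _ _ _ _ _ _ _ (h1 0) (h1 1) (h1 2) (h2 0) (h2 1) (h2 2)
  have e : ∑ i, (z i).val = (z (0, 0)).val + (z (0, 1)).val + (z (0, 2)).val +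
      ((z (1, 0)).val + (z (1, 1)).val + (z (1, 2)).val) +
      ((z (2, 0)).val + (z (2, 1)).val + (z (2, 2)).val) := by
    simp [Fintype.sum_prod_type, Fin.sum_univ_three]
  rw [← e] at this
  refine this.resolve_left fun hs => ?_
  obtain ⟨i, hi⟩ := h
  exact hi ((ZMod.val_eq_zero _).1 (Finset.sum_eq_zero_iff.1 hs i (Finset.mem_univ i)))

namespace SimpleGraph

/-- In a connected graph, the branch sets of a minor can be enlarged to cover all vertices. -/
theorem IsMinorOf.exists_total {V W : Type*} [Finite V] [Nonempty W] {G : SimpleGraph V}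
    {H : SimpleGraph W} (hG : G.Connected) (h : H.IsMinorOf G) :
    ∃ β : V → W, (∀ w, (G.induce {v | β v = w}).Connected) ∧
      ∀ w₁ w₂, H.Adj w₁ w₂ → ∃ v₁ v₂, β v₁ = w₁ ∧ β v₂ = w₂ ∧ G.Adj v₁ v₂ := by
  classical
  obtain ⟨f, hf⟩ := h
  induction hm : Set.ncard {v | f v = none} using Nat.strong_induction_on generalizing f with
  | _ m ih =>
  by_cases hnone : ∃ u, f u = none
  · obtain ⟨u, hu⟩ := hnone
    obtain ⟨w₀⟩ := ‹Nonempty W›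
    obtain ⟨⟨v₀, hv₀⟩⟩ := (hf.1 w₀).nonempty
    obtain ⟨p⟩ := hG.preconnected u v₀
    obtain ⟨d, -, hd1, hd2⟩ := p.exists_boundary_dart {v | f v = none} hu
      (by simp only [Set.mem_ofPred_eq] at hv₀ ⊢; simp [hv₀])
    set x := d.fst
    set y := d.snd
    have hxy : G.Adj x y := d.adj
    simp only [Set.mem_ofPred_eq] at hd1 hd2
    obtain ⟨w, hw⟩ := Option.ne_none_iff_exists'.1 hd2
    refine ih _ ?_ (Function.update f x (some w)) ⟨fun w' => ?_, fun w₁ w₂ hadj => ?_⟩ rfl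
    · rw [← hm]
      refine Set.ncard_lt_ncard ⟨fun v hv => ?_, fun hsub => ?_⟩ (Set.toFinite _)
      · by_cases hvx : v = x
        · subst hvx; simp at hv
        · simpa [hvx] using hv
      · have := hsub hd1
        simp at this
    · by_cases hww : w' = w
      · subst hww
        have e : {v | Function.update f x (some w') v = some w'} = {x} ∪ {v | f v = some w'} := by
          ext v
          by_cases hvx : v = x <;> simp [hvx]
        rw [e]
        refine connected_induce_union (v := x) (w := y) ?_ (hf.1 w').preconnected rfl hw hxy
        rw [induce_singleton_eq_top]
        exact preconnected_top
      · have e : {v | Function.update f x (some w) v = some w'} = {v | f v = some w'} := by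
          ext v
          by_cases hvx : v = x
          · subst hvx; simp [hd1, Ne.symm hww]
          · simp [hvx]
        rw [e]
        exact hf.1 w'
    · obtain ⟨v₁, v₂, h1, h2, h3⟩ := hf.2 w₁ w₂ hadj
      refine ⟨v₁, v₂, ?_, ?_, h3⟩
      · rw [Function.update_of_ne, h1]
        rintro rfl; simp [hd1] at h1
      · rw [Function.update_of_ne, h2]
        rintro rfl; simp [hd1] at h2
  · push Not at hnone
    choose β hβ using fun v => Option.ne_none_iff_exists'.1 (hnone v)
    refine ⟨β, fun w => ?_, by simpa [hβ] using hf.2⟩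
    have e : {v | β v = w} = {v | f v = some w} := by ext v; simp [hβ]
    rw [e]
    exact hf.1 w

end SimpleGraph

namespace SphereMap

variable {V E F W ι : Type*} [Fintype V] [Fintype E] [Fintype F] [DecidableEq V]
  [Fintype W] [Fintype ι] {s t : E → V} {l r : E → F}

/-- A minor of a connected graph on the sphere inherits a face structure: each of its at least
`|ι| - |W| + 2` faces is bounded by a nonempty even set of edges, and each edge is on at most two
faces. -/
theorem exists_faces_of_isMinorOf [Nonempty W] (h : SphereMap s t l r) {G : SimpleGraph V}
    (hG : G.Connected) (hGE : ∀ u v, G.Adj u v → ∃ e, s(s e, t e) = s(u, v))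
 {H : SimpleGraph W} (hH : H.IsMinorOf G)
    (a b : ι → W) (hab : ∀ i, H.Adj (a i) (b i))
    (hinj : ∀ i j, s(a i, b i) = s(a j, b j) → i = j)
    (hcard : Fintype.card W ≤ Fintype.card ι) :
    ∃ (P : Type) (_ : Fintype P) (z : P → ι → ZMod 2),
      Fintype.card ι + 2 ≤ Fintype.card P + Fintype.card W ∧
      (∀ p, (∃ i, z p i ≠ 0) ∧ ∀ χ : W → ZMod 2, ∑ i, z p i * (χ (a i) + χ (b i)) = 0) ∧
      ∑ p, ∑ i, (z p i).val ≤ 2 * Fintype.card ι := by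
  obtain ⟨β, hβ, hadj⟩ := hH.exists_total hG
  have hc : ∀ i, ∃ e, s(β (s e), β (t e)) = s(a i, b i) := by
    intro i
    obtain ⟨v₁, v₂, h1, h2, h3⟩ := hadj _ _ (hab i)
    obtain ⟨e, he⟩ := hGE _ _ h3
    refine ⟨e, ?_⟩
    rw [← h1, ← h2]
    exact congrArg (Sym2.map β) he
  choose c hc using hc
  have hβ' : ∀ ψ : V → ZMod 2, (∀ e, β (s e) = β (t e) → ψ (s e) = ψ (t e)) →
      ∀ u v, β u = β v → ψ u = ψ v := by
    intro ψ hψ u v huv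
    obtain ⟨p⟩ := (hβ (β v)).preconnected ⟨u, huv⟩ ⟨v, rfl⟩
    have key : ∀ x y : {x | β x = β v}, (G.induce {x | β x = β v}).Walk x y →
        ψ x = ψ y := by
      intro x y p
      induction p with
      | nil => rfl
      | @cons x y z hxy _ ih =>
        rw [← ih]
        have hx : β x = β v := x.2
        have hy : β y = β v := y.2
        obtain ⟨e, he⟩ := hGE _ _ hxy
        rcases Sym2.eq_iff.1 he with ⟨h1, h2⟩ | ⟨h1, h2⟩
        · have := hψ e (by rw [h1, h2]; exact hx.trans hy.symm)
          rw [h1, h2] at this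
          exact this
        · have := hψ e (by rw [h1, h2]; exact hy.trans hx.symm)
          rw [h1, h2] at this
          exact this.symm
    exact key _ _ p
  obtain ⟨P, _, _, L, R, hP, hLR⟩ := h.exists_faces β hβ' c
    (fun i j hij => hinj i j (by rw [← hc, ← hc, hij]))
    (fun i heq => by
      have := hc i
      have hne := (hab i).ne
      rw [heq] at this
      rcases Sym2.eq_iff.1 this with ⟨h1, h2⟩ | ⟨h1, h2⟩
      · exact hne (h1.symm.trans h2)
      · exact hne (h2.symm.trans h1)) hcard
  refine ⟨P, inferInstance, fun p i => (if L i = p then 1 else 0) + (if R i = p then 1 else 0),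
    hP, fun p => ⟨(hLR p).1, fun χ => ?_⟩, ?_⟩
  · refine (Finset.sum_congr rfl fun i _ => ?_).trans ((hLR p).2 χ)
    congr 1
    rcases Sym2.eq_iff.1 (hc i) with ⟨h1, h2⟩ | ⟨h1, h2⟩
    · rw [h1, h2]
    · rw [h1, h2, add_comm]
  · rw [Finset.sum_comm]
    have : ∀ i, ∑ p, ((if L i = p then (1 : ZMod 2) else 0) + (if R i = p then 1 else 0)).val
        ≤ 2 := by
      intro i
      calc _ ≤ ∑ p, ((if L i = p then 1 else 0) + (if R i = p then 1 else 0)) := by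
            refine Finset.sum_le_sum fun p _ => ?_
            split_ifs <;> decide
        _ = 2 := by simp [Finset.sum_add_distrib]
    calc _ ≤ ∑ _i : ι, 2 := Finset.sum_le_sum fun i _ => this i
      _ = _ := by simp [mul_comm]

theorem planar (h : SphereMap s t l r) {G : SimpleGraph V}
    (hG : G.Connected) (hGE : ∀ u v, G.Adj u v → ∃ e, s(s e, t e) = s(u, v)) :
    G.Planar := by
  constructor
  · intro hH
    obtain ⟨P, _, z, hP, hz, hsum⟩ := h.exists_faces_of_isMinorOf hG hGE hH
      (![0, 0, 0, 0, 1, 1, 1, 2, 2, 3] : Fin 10 → Fin 5) ![1, 2, 3, 4, 2, 3, 4, 3, 4, 4]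
      (by decide) (by decide) (by decide)
    have h3 : ∀ p, 3 ≤ ∑ i, (z p i).val := by
      intro p
      have hχ := fun w : Fin 5 => (hz p).2 fun w' => if w' = w then 1 else 0
      have h0 := hχ 0
      have h1 := hχ 1
      have h2 := hχ 2
      have h3 := hχ 3
      simp [Fin.sum_univ_succ, ← add_assoc] at h0 h1 h2 h3
      exact three_le_of_even_K5 (z p) h0 h1 h2 h3 (hz p).1
    have := Finset.sum_le_sum fun p (_ : p ∈ Finset.univ) => h3 p
    simp at this hsum hP
    omega
  · intro hH
    obtain ⟨P, _, z, hP, hz, hsum⟩ := h.exists_faces_of_isMinorOf hG hGE hH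
      (fun i : Fin 3 × Fin 3 => Sum.inl i.1) (fun i => Sum.inr i.2)
      (by simp) (by simp [Prod.ext_iff]) (by decide)
    have h4 : ∀ p, 4 ≤ ∑ i, (z p i).val := by
      intro p
      have hχ := fun w : Fin 3 ⊕ Fin 3 => (hz p).2 fun w' => if w' = w then 1 else 0
      refine four_le_of_even_K33 (z p) (fun i => ?_) (fun j => ?_) (hz p).1
      · have := hχ (Sum.inl i)
        fin_cases i <;> simpa [Fintype.sum_prod_type, Fin.sum_univ_three] using this
      · have := hχ (Sum.inr j)
        fin_cases j <;> simpa [Fintype.sum_prod_type_right, Fin.sum_univ_three] using this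
    have := Finset.sum_le_sum fun p (_ : p ∈ Finset.univ) => h4 p
    simp at this hsum hP
    omega

end SphereMap

/-- The Haar graph of `S`: the bipartite graph on two copies of `A` with `i` adjacent to `i + q`
for `q ∈ S`. -/
def haarGraph {A : Type*} [AddCommGroup A] (S : Set A) : SimpleGraph (A ⊕ A) where
  Adj
    | Sum.inl i, Sum.inr j => j - i ∈ S
    | Sum.inr j, Sum.inl i => j - i ∈ S
    | _, _ => False
  symm := ⟨by rintro (i | i) (j | j) h <;> exact h⟩
  loopless := ⟨by rintro (i | i) h <;> exact h⟩

theorem Gamma_empty_eq_haarGraph (n : ℕ) (Q : Finset ℕ) :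
    Gamma n ∅ ∅ Q = haarGraph (Q.image (fun x : ℕ => (x : ZMod n)) : Finset (ZMod n)) := by
  ext x y
  rcases x with i | i <;> rcases y with j | j <;>
    simp [Gamma, haarGraph, SimpleGraph.fromRel_adj, sub_eq_iff_eq_add', eq_comm]

namespace haarGraph

variable {A : Type*} [AddCommGroup A] {S : Set A}

theorem adj_add {q : A} (hq : q ∈ S) (i : A) :
    (haarGraph S).Adj (Sum.inl i) (Sum.inr (i + q)) := by
  simpa [haarGraph] using hq

theorem adj_iff {i j : A} : (haarGraph S).Adj (Sum.inl i) (Sum.inr j) ↔ j - i ∈ S := Iff.rfl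

theorem connected {q s : A} (hq : q ∈ S) (hqs : q + s ∈ S)
    (hs : AddSubgroup.zmultiples s = ⊤) : (haarGraph S).Connected := by
  have step : ∀ i, (haarGraph S).Reachable (Sum.inl i) (Sum.inl (i + s)) := by
    intro i
    have h1 := adj_add hqs i
    have h2 := adj_add hq (i + s)
    rw [add_right_comm, add_assoc] at h2
    exact h1.reachable.trans h2.symm.reachable
  have hz : ∀ k : ℤ, (haarGraph S).Reachable (Sum.inl 0) (Sum.inl (k • s)) := by
    intro k
    induction k using Int.induction_on with
    | zero => simp
    | succ k ih => rw [add_zsmul, one_zsmul]; exact ih.trans (step _)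
    | pred k ih =>
      refine ih.trans ?_
      have := step ((-(k : ℤ) - 1) • s)
      rw [sub_zsmul, one_zsmul, ← sub_eq_add_neg, sub_add_cancel] at this
      rw [sub_zsmul, one_zsmul, ← sub_eq_add_neg]
      exact this.symm
  have h0 : ∀ x, (haarGraph S).Reachable (Sum.inl 0) x := by
    have hl : ∀ i, (haarGraph S).Reachable (Sum.inl 0) (Sum.inl i) := by
      intro i
      obtain ⟨k, rfl⟩ := AddSubgroup.mem_zmultiples_iff.1 (hs ▸ AddSubgroup.mem_top i)
      exact hz k
    rintro (i | j)
    · exact hl i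
    · have := adj_add hq (j - q)
      rw [sub_add_cancel] at this
      exact (hl _).trans this.reachable
  have : Nonempty (A ⊕ A) := ⟨Sum.inl 0⟩
  exact ⟨fun x y => (h0 x).symm.trans (h0 y)⟩

/-- Connectivity forces the differences of `S` to generate the whole group. -/
theorem eq_top_of_connected (h : (haarGraph S).Connected) (q : A) (H : AddSubgroup A)
    (hH : ∀ p ∈ S, p - q ∈ H) : H = ⊤ := by
  let P : A ⊕ A → Prop := Sum.elim (fun i => i ∈ H) (fun j => j - q ∈ H)
  have key : ∀ x y, (haarGraph S).Adj x y → (P x ↔ P y) := by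
    have : ∀ i j, j - i ∈ S → (i ∈ H ↔ j - q ∈ H) := by
      intro i j hij
      have := hH _ hij
      rw [← H.add_mem_cancel_left this]
      congr! 1
      abel
    rintro (i | i) (j | j) hij
    · exact hij.elim
    · exact this _ _ hij
    · exact (this _ _ hij).symm
    · exact hij.elim
  have walk : ∀ x y, (haarGraph S).Walk x y → (P x ↔ P y) := by
    intro x y p
    induction p with
    | nil => rfl
    | cons hxy _ ih => exact (key _ _ hxy).trans ih
  rw [eq_top_iff]
  rintro i -
  obtain ⟨p⟩ := h.preconnected (Sum.inl 0) (Sum.inl i)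
  exact (walk _ _ p).1 H.zero_mem

theorem planar_pair [Fintype A] {q s : A} (hs : AddSubgroup.zmultiples s = ⊤) :
    (haarGraph ({q, q + s} : Set A)).Planar := by
  classical
  have hG := connected (S := {q, q + s}) (q := q) (s := s) (by simp) (by simp) hs
  refine SphereMap.planar (E := A × Bool) (F := Bool)
    (s := fun e => Sum.inl e.1) (t := fun e => Sum.inr (e.1 + if e.2 then q else q + s))
    (l := fun _ => false) (r := fun _ => true) ⟨?_, ?_, ?_⟩ hG ?_
  · rintro φ (i | j)
    · simp [Fintype.sum_prod_type, CharTwo.add_self_eq_zero]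
    · simp [Fintype.sum_prod_type_right, ← eq_sub_iff_add_eq, CharTwo.add_self_eq_zero]
  · intro φ h f g
    have := h (0, true)
    cases f <;> cases g <;> simp_all
  · simp; ring
  · have : ∀ i j, j - i ∈ ({q, q + s} : Set A) → ∃ b : Bool, i + (if b then q else q + s) = j := by
      rintro i j (h | h)
      · exact ⟨true, by rw [← h]; simp⟩
      · exact ⟨false, by simp [← Set.mem_singleton_iff.1 h]⟩
    rintro (i | i) (j | j) hij
    · exact hij.elim
    · obtain ⟨b, hb⟩ := this _ _ hij
      exact ⟨(i, b), by simp [hb]⟩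
    · obtain ⟨b, hb⟩ := this _ _ hij
      exact ⟨(j, b), by simp [hb]⟩
    · exact hij.elim

theorem planar_prism [Fintype A] {q s : A} (hs : AddSubgroup.zmultiples s = ⊤)
    (χ : A →+ ZMod 2) (hχ : χ s = 1) :
    (haarGraph ({q, q + s, q - s} : Set A)).Planar := by
  classical
  have hG := connected (S := {q, q + s, q - s}) (q := q) (s := s) (by simp) (by simp) hs
  refine SphereMap.planar (E := A × Fin 3) (F := A ⊕ ZMod 2)
    (s := fun e => Sum.inl e.1) (t := fun e => Sum.inr (e.1 + ![q, q + s, q - s] e.2))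
    (l := fun e => Sum.inl (![e.1, e.1, e.1 - s] e.2))
    (r := fun e => ![Sum.inl (e.1 - s), Sum.inr (χ e.1), Sum.inr (χ e.1)] e.2)
    ⟨?_, ?_, ?_⟩ hG ?_
  · rintro φ (i | j)
    · simp [Fintype.sum_prod_type_right, Fin.sum_univ_three]
      grind
    · have e1 : j - (q + s) + s = j - q := by abel
      have e2 : j - (q - s) - s = j - q := by abel
      have e3 : j - (q + s) = j - q - s := by abel
      have e4 : χ (j - (q + s)) = χ (j - (q - s)) := by
        have : j - (q - s) = j - (q + s) + s + s := by abel
        rw [this, map_add, map_add, add_assoc, hχ]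
        simp [CharTwo.add_self_eq_zero]
      simp [Fintype.sum_prod_type_right, Fin.sum_univ_three, ← eq_sub_iff_add_eq, -map_sub,
        e2, e3]
      grind
  · intro φ h
    have h0 : ∀ i, φ (Sum.inl i) = φ (Sum.inl (i - s)) := fun i => h (i, 0)
    have h1 : ∀ i, φ (Sum.inl i) = φ (Sum.inr (χ i)) := fun i => h (i, 1)
    have hz : ∀ k : ℤ, φ (Sum.inl (k • s)) = φ (Sum.inl 0) := by
      intro k
      induction k using Int.induction_on with
      | zero => simp
      | succ k ih => rw [h0, add_zsmul, one_zsmul, add_sub_cancel_right, ih]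
      | pred k ih => rw [sub_zsmul, one_zsmul, ← sub_eq_add_neg, ← h0, ih]
    have hl : ∀ i, φ (Sum.inl i) = φ (Sum.inl 0) := by
      intro i
      obtain ⟨k, rfl⟩ := AddSubgroup.mem_zmultiples_iff.1 (hs ▸ AddSubgroup.mem_top i)
      exact hz k
    have hr : ∀ c, φ (Sum.inr c) = φ (Sum.inl 0) := by
      intro c
      obtain ⟨i, rfl⟩ : ∃ i, χ i = c := by
        fin_cases c
        exacts [⟨0, map_zero χ⟩, ⟨s, hχ⟩]
      exact (h1 i).symm.trans (hl i)
    have : ∀ f, φ f = φ (Sum.inl 0) := by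
      rintro (i | c)
      exacts [hl i, hr c]
    intro f g
    rw [this, this g]
  · simp; ring
  · have : ∀ i j, j - i ∈ ({q, q + s, q - s} : Set A) →
        ∃ k : Fin 3, i + ![q, q + s, q - s] k = j := by
      rintro i j (h | h | h)
      · exact ⟨0, by simp [← h]⟩
      · exact ⟨1, by simp [← h]⟩
      · exact ⟨2, by simp [← Set.mem_singleton_iff.1 h]⟩
    rintro (i | i) (j | j) hij
    · exact hij.elim
    · obtain ⟨b, hb⟩ := this _ _ hij
      exact ⟨(i, b), by simp [hb]⟩
    · obtain ⟨b, hb⟩ := this _ _ hij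
      exact ⟨(j, b), by simp [hb]⟩
    · exact hij.elim

end haarGraph

namespace SimpleGraph

variable {V W : Type*} {G : SimpleGraph V}

theorem isMinorOf_of_branchSets {H : SimpleGraph W} (B : W → Set V)
    (hdisj : ∀ w₁ w₂ v, v ∈ B w₁ → v ∈ B w₂ → w₁ = w₂)
    (hconn : ∀ w, (G.induce (B w)).Connected)
    (hadj : ∀ w₁ w₂, H.Adj w₁ w₂ → ∃ v₁ ∈ B w₁, ∃ v₂ ∈ B w₂, G.Adj v₁ v₂) : H.IsMinorOf G := by
  classical
  let f : V → Option W := fun v => if h : ∃ w, v ∈ B w then some h.choose else none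
  have hf : ∀ v w, f v = some w ↔ v ∈ B w := by
    intro v w
    by_cases h : ∃ w, v ∈ B w
    · simp only [f, h, dif_pos, Option.some_inj]
      exact ⟨fun e => e ▸ h.choose_spec, fun hw => hdisj _ _ v h.choose_spec hw⟩
    · simp only [f, h, dif_neg, not_false_eq_true, reduceCtorEq, false_iff]
      exact fun hw => h ⟨w, hw⟩
  refine ⟨f, fun w => ?_, fun w₁ w₂ h => ?_⟩
  · have : {v | f v = some w} = B w := by ext v; exact hf v w
    rw [this]
    exact hconn w
  · obtain ⟨v₁, h1, v₂, h2, h3⟩ := hadj w₁ w₂ h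
    exact ⟨v₁, v₂, (hf _ _).2 h1, (hf _ _).2 h2, h3⟩

theorem induce_singleton_connected (v : V) : (G.induce {v}).Connected := by
  rw [induce_singleton_eq_top]
  exact connected_top

/-- A chain of connected sets has a connected union. -/
theorem induce_iUnion_Ico_connected (S : ℕ → Set V) {m n : ℕ} (hmn : m < n)
    (hconn : ∀ j, (G.induce (S j)).Connected)
    (hadj : ∀ j, ∃ u ∈ S j, ∃ v ∈ S (j + 1), G.Adj u v) :
    (G.induce (⋃ j ∈ Set.Ico m n, S j)).Connected := by
  induction n, hmn using Nat.le_induction with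
  | base =>
    have : (⋃ j ∈ Set.Ico m (m + 1), S j) = S m := by
      ext v; simp [← le_antisymm_iff]
    rw [this]
    exact hconn m
  | succ n hmn ih =>
    have : (⋃ j ∈ Set.Ico m (n + 1), S j) = (⋃ j ∈ Set.Ico m n, S j) ∪ S n := by
      rw [Set.biUnion_eq_iUnion, Set.biUnion_eq_iUnion]
      ext v
      simp only [Set.mem_iUnion, Set.mem_union, Subtype.exists, Set.mem_Ico, exists_prop]
      constructor
      · rintro ⟨j, hj, hv⟩
        by_cases hjn : j = n
        · exact Or.inr (hjn ▸ hv)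
        · exact Or.inl ⟨j, by omega, hv⟩
      · rintro (⟨j, hj, hv⟩ | hv)
        · exact ⟨j, by omega, hv⟩
        · exact ⟨n, by omega, hv⟩
    rw [this]
    obtain ⟨k, rfl⟩ : ∃ k, n = k + 1 := ⟨n - 1, by omega⟩
    obtain ⟨u, hu, v, hv, huv⟩ := hadj k
    refine connected_induce_union ih.preconnected (hconn _).preconnected ?_ hv huv
    simp only [Set.mem_iUnion]
    exact ⟨k, ⟨by omega, by omega⟩, hu⟩

/-- A cycle with three pairwise crossing chords contains `K_{3,3}` as a minor. -/
theorem K33_isMinorOf_of_crossing_chords (c : ℕ → V) (p : Fin 7 → ℕ) (hp : StrictMono p)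
    (h0 : p 0 = 0) (hinj : Set.InjOn c (Set.Iio (p 6))) (hc : c (p 6) = c 0)
    (hadj : ∀ i, G.Adj (c i) (c (i + 1))) (h03 : G.Adj (c (p 0)) (c (p 3)))
    (h14 : G.Adj (c (p 1)) (c (p 4))) (h25 : G.Adj (c (p 2)) (c (p 5))) :
    (completeBipartiteGraph (Fin 3) (Fin 3)).IsMinorOf G := by
  let B : Fin 6 → Set V := fun k => ⋃ i ∈ Set.Ico (p k.castSucc) (p k.succ), {c i}
  have hB : ∀ k v, v ∈ B k ↔ ∃ i, p k.castSucc ≤ i ∧ i < p k.succ ∧ c i = v := by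
    intro k v
    simp [B, eq_comm, and_assoc]
  have hlast : ∀ k : Fin 6, p k.succ ≤ p 6 := fun k => hp.monotone (Fin.le_last _)
  have hdisj : ∀ k k' v, v ∈ B k → v ∈ B k' → k = k' := by
    have key : ∀ k k' v, v ∈ B k → v ∈ B k' → ¬ k < k' := by
      intro k k' v hk hk' hlt
      obtain ⟨i, h1, h2, rfl⟩ := (hB _ _).1 hk
      obtain ⟨j, h3, h4, hij⟩ := (hB _ _).1 hk'
      have h5 : p k.succ ≤ p k'.castSucc := hp.monotone (by
        rw [Fin.le_def]; simpa using hlt)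
      have := hinj (show j < p 6 from h4.trans_le (hlast _))
        (show i < p 6 from h2.trans_le (hlast _)) hij
      omega
    intro k k' v hk hk'
    exact le_antisymm (not_lt.1 (key _ _ _ hk' hk)) (not_lt.1 (key _ _ _ hk hk'))
  have hconn : ∀ k, (G.induce (B k)).Connected := fun k =>
    induce_iUnion_Ico_connected (fun i => {c i}) (hp k.castSucc_lt_succ)
      (fun i => induce_singleton_connected _) fun i => ⟨_, rfl, _, rfl, hadj i⟩
  have hstart : ∀ k : Fin 6, c (p k.castSucc) ∈ B k := fun k =>
    (hB _ _).2 ⟨_, le_rfl, hp k.castSucc_lt_succ, rfl⟩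
  have hnext : ∀ k : Fin 6, ∃ v ∈ B k, G.Adj v (c (p k.succ)) := by
    intro k
    have := hp k.castSucc_lt_succ
    refine ⟨c (p k.succ - 1), (hB _ _).2 ⟨_, by omega, by omega, rfl⟩, ?_⟩
    have h := hadj (p k.succ - 1)
    rwa [Nat.sub_add_cancel (by omega)] at h
  have hsymm : ∀ k k', (∃ u ∈ B k, ∃ v ∈ B k', G.Adj u v) → ∃ u ∈ B k', ∃ v ∈ B k, G.Adj u v :=
    fun _ _ ⟨u, hu, v, hv, h⟩ => ⟨v, hv, u, hu, h.symm⟩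
  have hstep : ∀ k k' : Fin 6, k.succ = k'.castSucc → ∃ u ∈ B k, ∃ v ∈ B k', G.Adj u v := by
    intro k k' h
    obtain ⟨v, hv, hv'⟩ := hnext k
    exact ⟨v, hv, _, hstart k', h ▸ hv'⟩
  have hwrap : ∃ u ∈ B 5, ∃ v ∈ B 0, G.Adj u v := by
    obtain ⟨v, hv, hv'⟩ := hnext 5
    refine ⟨v, hv, _, hstart 0, ?_⟩
    have e : c (p (Fin.castSucc 0)) = c (p (Fin.succ 5)) := by
      change c (p 0) = c (p 6)
      rw [hc, h0]
    rw [e]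
    exact hv'
  have hinl : ∀ i j : Fin 3, ∃ u ∈ B (![0, 2, 4] i), ∃ v ∈ B (![1, 3, 5] j), G.Adj u v := by
    intro i j
    fin_cases i <;> fin_cases j
    · exact hstep 0 1 rfl
    · exact ⟨_, hstart 0, _, hstart 3, h03⟩
    · exact hsymm _ _ hwrap
    · exact hsymm _ _ (hstep 1 2 rfl)
    · exact hstep 2 3 rfl
    · exact ⟨_, hstart 2, _, hstart 5, h25⟩
    · exact hsymm _ _ ⟨_, hstart 1, _, hstart 4, h14⟩
    · exact hsymm _ _ (hstep 3 4 rfl)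
    · exact hstep 4 5 rfl
  let κ : Fin 3 ⊕ Fin 3 → Fin 6 := Sum.elim ![0, 2, 4] ![1, 3, 5]
  have hκ : ∀ x y, κ x = κ y → x = y := by decide
  refine isMinorOf_of_branchSets (fun x => B (κ x))
    (fun x y v hx hy => hκ _ _ (hdisj _ _ v hx hy)) (fun x => hconn _) ?_
  rintro (i | i) (j | j) hij
  · simp at hij
  · exact hinl i j
  · exact hsymm _ _ (hinl j i)
  · simp at hij

end SimpleGraph

namespace haarGraph

variable {A : Type*} [AddCommGroup A] {S : Set A}

theorem not_planar_of_chords {q a : A} {k : ℕ} (hq : q ∈ S) (hqa : q + a ∈ S)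
    (hqk : q + k • a ∈ S) (hk : 3 ≤ k) (hk' : k + 2 ≤ addOrderOf a) :
    ¬ (haarGraph S).Planar := by
  intro hplanar
  set m := addOrderOf a with hm
  let c : ℕ → A ⊕ A := fun i =>
    if Even i then Sum.inl ((i / 2) • a) else Sum.inr ((i / 2 + 1) • a + q)
  have hce : ∀ i, c (2 * i) = Sum.inl (i • a) := by intro i; simp [c]
  have hco : ∀ i, c (2 * i + 1) = Sum.inr ((i + 1) • a + q) := by
    intro i
    have : (2 * i + 1) / 2 = i := by omega
    simp [c, this, parity_simps]
  have hchord : ∀ i, (haarGraph S).Adj (c (2 * i)) (c (2 * (i + k - 1) + 1)) := by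
    intro i
    rw [hce, hco, Nat.sub_add_cancel (by omega), adj_iff, add_smul]
    convert hqk using 1
    abel
  have hinj : ∀ i < m, ∀ j < m, i • a = j • a → i = j := fun i hi j hj h =>
    nsmul_injOn_Iio_addOrderOf hi hj h
  refine hplanar.2 (SimpleGraph.K33_isMinorOf_of_crossing_chords c
    ![0, 2, 4, 2 * k - 1, 2 * k + 1, 2 * k + 3, 2 * m] ?_ rfl ?_ ?_ ?_ ?_ ?_ ?_)
  · rw [Fin.strictMono_iff_lt_succ]
    intro i
    fin_cases i <;> simp <;> omega
  · change Set.InjOn c (Set.Iio (2 * m))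
    intro i hi j hj hij
    simp only [Set.mem_Iio] at hi hj
    rcases Nat.even_or_odd' i with ⟨x, rfl | rfl⟩ <;>
      rcases Nat.even_or_odd' j with ⟨y, rfl | rfl⟩
    · rw [hce, hce] at hij
      rw [hinj x (by omega) y (by omega) (Sum.inl_injective hij)]
    · rw [hce, hco] at hij; cases hij
    · rw [hce, hco] at hij; cases hij
    · rw [hco, hco] at hij
      have := Sum.inr_injective hij
      simp only [add_smul, add_left_inj] at this
      rw [hinj x (by omega) y (by omega) this]
  · change c (2 * m) = c (2 * 0)
    rw [hce, hce, hm, addOrderOf_nsmul_eq_zero, zero_smul]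
  · intro i
    rcases Nat.even_or_odd' i with ⟨x, rfl | rfl⟩
    · rw [hce, hco, adj_iff, add_smul]
      convert hqa using 1
      rw [one_smul]; abel
    · have : 2 * x + 1 + 1 = 2 * (x + 1) := by ring
      rw [this, hco, hce, SimpleGraph.adj_comm, adj_iff]
      simpa using hq
  · have := hchord 0
    have e : 2 * (0 + k - 1) + 1 = 2 * k - 1 := by omega
    rwa [e] at this
  · have := hchord 1
    have e : 2 * (1 + k - 1) + 1 = 2 * k + 1 := by omega
    rwa [e] at this
  · have := hchord 2
    have e : 2 * (2 + k - 1) + 1 = 2 * k + 3 := by omega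
    rwa [e] at this

theorem not_planar_of_progression {q a : A} (ha : a ≠ 0) (h2a : a + a ≠ 0) (h0 : q ∈ S)
    (h1 : q + a ∈ S) (h2 : q + a + a ∈ S) (h3 : q - a ∈ S) (h4 : q - a - a ∈ S) :
    ¬ (haarGraph S).Planar := by
  intro hplanar
  have hinj : ∀ i j : Fin 3, i.val • a = j.val • a → i = j := by
    intro i j h
    fin_cases i <;> fin_cases j <;> simp_all [two_smul]
  refine hplanar.2 (SimpleGraph.isMinorOf_of_branchSets
    (Sum.elim (fun i : Fin 3 => {Sum.inl (i.val • a)})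
      (fun j : Fin 3 => {Sum.inr (j.val • a + q)})) ?_ ?_ ?_)
  · rintro (i | i) (j | j) v hi hj <;> simp at hi hj <;> subst hi
    · rw [hinj i j (Sum.inl_injective hj)]
    · cases hj
    · cases hj
    · rw [hinj i j (by simpa using hj)]
  · rintro (i | i) <;> exact SimpleGraph.induce_singleton_connected _
  · have key : ∀ i j : Fin 3, (haarGraph S).Adj (Sum.inl (i.val • a)) (Sum.inr (j.val • a + q)) := by
      intro i j
      rw [adj_iff]
      fin_cases i <;> fin_cases j <;> simp [two_smul]
      · exact h0
      · rwa [add_comm]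
      · rwa [add_comm, ← add_assoc]
      · exact h3
      · exact h0
      · convert h1 using 1; abel
      · convert h4 using 1; abel
      · convert h3 using 1
      · exact h0
    rintro (i | i) (j | j) hij
    · simp at hij
    · exact ⟨_, rfl, _, rfl, key i j⟩
    · exact ⟨_, rfl, _, rfl, (key j i).symm⟩
    · simp at hij

/-- If `b` and `2 • b` are outside the subgroup generated by `a`, the cosets of this subgroup give a
cylinder with connected ends, hence a `K₅` minor. -/
theorem not_planar_of_cosets [Finite A] {q a b : A} (hq : q ∈ S) (hqa : q + a ∈ S)
    (hqb : q + b ∈ S) (ha : 3 ≤ addOrderOf a) (hb : b ∉ AddSubgroup.zmultiples a)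
    (h2b : 2 • b ∉ AddSubgroup.zmultiples a) : ¬ (haarGraph S).Planar := by
  classical
  intro hplanar
  let Z := AddSubgroup.zmultiples a
  have haZ : ∀ k : ℕ, k • a ∈ Z := fun k => AddSubgroup.nsmul_mem_zmultiples a k
  have hex : ∃ r : ℕ, 0 < r ∧ r • b ∈ Z :=
    ⟨addOrderOf b, addOrderOf_pos b, by rw [addOrderOf_nsmul_eq_zero]; exact Z.zero_mem⟩
  let r := Nat.find hex
  obtain ⟨hr0, hrZ⟩ : 0 < r ∧ r • b ∈ Z := Nat.find_spec hex
  have hmin : ∀ j, 0 < j → j < r → j • b ∉ Z := fun j h0 hj hjZ =>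
    Nat.find_min hex hj ⟨h0, hjZ⟩
  have hr : 3 ≤ r := by
    by_contra! hlt
    have : r = 1 ∨ r = 2 := by omega
    rcases this with h | h <;> rw [h] at hrZ
    · exact hb (by simpa using hrZ)
    · exact h2b hrZ
  set m := addOrderOf a with hm
  have hma : m • a = 0 := addOrderOf_nsmul_eq_zero a
  let π : A ⊕ A → A := Sum.elim id (fun j => j - q)
  have hadj : ∀ (T T' : Set A) (i d : A), q + d ∈ S → i ∈ T → i + d ∈ T' →
      ∃ u ∈ π ⁻¹' T, ∃ v ∈ π ⁻¹' T', (haarGraph S).Adj u v := by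
    intro T T' i d hd hi hid
    refine ⟨Sum.inl i, hi, Sum.inr (i + (q + d)), ?_, adj_add hd i⟩
    have : i + (q + d) - q = i + d := by abel
    simpa [π, this] using hid
  have hpoint : ∀ i, ((haarGraph S).induce (π ⁻¹' {i})).Connected := by
    intro i
    have : π ⁻¹' {i} = {Sum.inl i, Sum.inr (i + q)} := by
      ext x
      rcases x with x | x <;> simp [π, sub_eq_iff_eq_add]
    rw [this]
    exact SimpleGraph.induce_pair_connected_of_adj (adj_add hq i)
  have harc : ∀ (i : A) {lo hi : ℕ}, lo < hi →
      ((haarGraph S).induce (π ⁻¹' (⋃ k ∈ Set.Ico lo hi, {i + k • a}))).Connected := by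
    intro i lo hi h
    rw [Set.preimage_iUnion₂]
    refine SimpleGraph.induce_iUnion_Ico_connected (fun k => π ⁻¹' {i + k • a}) h
      (fun k => hpoint _) fun k => hadj _ _ _ a hqa rfl ?_
    rw [Set.mem_singleton_iff, add_smul, one_smul, add_assoc]
  let row : ℕ → Set A := fun j => {x | x - j • b ∈ Z}
  have hrow : ∀ j, ((haarGraph S).induce (π ⁻¹' (row j))).Connected := by
    intro j
    have : row j = ⋃ k ∈ Set.Ico 0 m, {j • b + k • a} := by
      ext x
      simp only [row, Set.mem_iUnion, Set.mem_singleton_iff, exists_prop, Set.mem_Ico]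
      constructor
      · intro hx
        obtain ⟨k, hk, hkx⟩ := Finset.mem_image.1 (mem_zmultiples_iff_mem_range_addOrderOf.1 hx)
        exact ⟨k, ⟨Nat.zero_le _, Finset.mem_range.1 hk⟩, by rw [hkx]; abel⟩
      · rintro ⟨k, -, rfl⟩
        show j • b + k • a - j • b ∈ Z
        rw [add_sub_cancel_left]
        exact haZ k
    rw [this]
    exact harc _ (by omega)
  have hmem : ∀ j k : ℕ, j • b + k • a ∈ row j := by
    intro j k
    show j • b + k • a - j • b ∈ Z
    rw [add_sub_cancel_left]
    exact haZ k
  have hrowdisj : ∀ i j x, i < j → j < r → x ∈ row i → x ∈ row j → False := by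
    intro i j x hij hj hi' hj'
    refine hmin (j - i) (by omega) (by omega) ?_
    have := Z.sub_mem hi' hj'
    have e : x - i • b - (x - j • b) = (j - i) • b := by
      rw [sub_nsmul _ hij.le]; abel
    rwa [e] at this
  let T : Fin 5 → Set A := ![row 0, ⋃ k ∈ Set.Ico 0 1, {b + k • a}, ⋃ k ∈ Set.Ico 1 2, {b + k • a},
    ⋃ k ∈ Set.Ico 2 m, {b + k • a}, ⋃ j ∈ Set.Ico 2 r, row j]
  have harcmem : ∀ {lo hi : ℕ} {x : A}, x ∈ (⋃ k ∈ Set.Ico lo hi, {b + k • a} : Set A) ↔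
      ∃ k, lo ≤ k ∧ k < hi ∧ x = b + k • a := by
    intro lo hi x
    simp [and_assoc]
  have harcrow : ∀ {lo hi : ℕ} {x : A}, x ∈ (⋃ k ∈ Set.Ico lo hi, {b + k • a} : Set A) →
      x ∈ row 1 := by
    intro lo hi x hx
    obtain ⟨k, -, -, rfl⟩ := harcmem.1 hx
    simpa using hmem 1 k
  have harcdisj : ∀ {lo hi lo' hi' : ℕ} {x : A}, hi ≤ lo' → hi' ≤ m →
      x ∈ (⋃ k ∈ Set.Ico lo hi, {b + k • a} : Set A) →
      x ∈ (⋃ k ∈ Set.Ico lo' hi', {b + k • a} : Set A) → False := by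
    intro lo hi lo' hi' x h1 h2 hx hx'
    obtain ⟨k, hk1, hk2, rfl⟩ := harcmem.1 hx
    obtain ⟨k', hk1', hk2', he⟩ := harcmem.1 hx'
    have := nsmul_injOn_Iio_addOrderOf (x := a) (show k < m by omega) (show k' < m by omega)
      (by simpa using he)
    omega
  have hendmem : ∀ {x : A}, x ∈ (⋃ j ∈ Set.Ico 2 r, row j) ↔ ∃ j, 2 ≤ j ∧ j < r ∧ x ∈ row j := by
    intro x
    simp [and_assoc]
  have henddisj : ∀ {i : ℕ} {x : A}, i < 2 → x ∈ row i → x ∈ (⋃ j ∈ Set.Ico 2 r, row j) → False := by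
    intro i x hi hx hx'
    obtain ⟨j, h1, h2, h3⟩ := hendmem.1 hx'
    exact hrowdisj i j x (by omega) h2 hx h3
  have hTdisj : ∀ i j : Fin 5, i < j → ∀ x, x ∈ T i → x ∈ T j → False := by
    intro i j hij x hi hj
    fin_cases i <;> fin_cases j <;> first | exact absurd hij (by decide) | skip
    · exact hrowdisj 0 1 x one_pos (by omega) hi (harcrow hj)
    · exact hrowdisj 0 1 x one_pos (by omega) hi (harcrow hj)
    · exact hrowdisj 0 1 x one_pos (by omega) hi (harcrow hj)
    · exact henddisj two_pos hi hj
    · exact harcdisj (by omega) (by omega) hi hj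
    · exact harcdisj (by omega) (by omega) hi hj
    · exact henddisj one_lt_two (harcrow hi) hj
    · exact harcdisj (by omega) (by omega) hi hj
    · exact henddisj one_lt_two (harcrow hi) hj
    · exact henddisj one_lt_two (harcrow hi) hj
  have hTconn : ∀ i, ((haarGraph S).induce (π ⁻¹' T i)).Connected := by
    intro i
    fin_cases i
    · exact hrow 0
    · exact harc b (by omega)
    · exact harc b (by omega)
    · exact harc b (by omega)
    · show ((haarGraph S).induce (π ⁻¹' (⋃ j ∈ Set.Ico 2 r, row j))).Connected
      rw [Set.preimage_iUnion₂]
      refine SimpleGraph.induce_iUnion_Ico_connected (fun j => π ⁻¹' (row j)) (by omega) hrow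
        fun j => hadj _ _ (j • b) b hqb ?_ ?_
      · simpa using hmem j 0
      · simpa [add_smul] using hmem (j + 1) 0
  have hrow0 : ∀ k : ℕ, k • a ∈ row 0 := fun k => by simpa using hmem 0 k
  have hrow2 : ∀ k : ℕ, b + k • a + b ∈ (⋃ j ∈ Set.Ico 2 r, row j) := by
    intro k
    refine hendmem.2 ⟨2, le_rfl, by omega, ?_⟩
    have e : b + k • a + b = 2 • b + k • a := by rw [two_smul]; abel
    rw [e]
    exact hmem 2 k
  have hTadj : ∀ i j : Fin 5, i < j → (∃ u ∈ π ⁻¹' T i, ∃ v ∈ π ⁻¹' T j, (haarGraph S).Adj u v) ∨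
      (∃ u ∈ π ⁻¹' T j, ∃ v ∈ π ⁻¹' T i, (haarGraph S).Adj u v) := by
    intro i j hij
    fin_cases i <;> fin_cases j <;> first | exact absurd hij (by decide) | skip
    · exact Or.inl (hadj _ _ _ b hqb (hrow0 0) (harcmem.2 ⟨0, by omega, by omega, add_comm _ _⟩))
    · exact Or.inl (hadj _ _ _ b hqb (hrow0 1) (harcmem.2 ⟨1, by omega, by omega, add_comm _ _⟩))
    · exact Or.inl (hadj _ _ _ b hqb (hrow0 2) (harcmem.2 ⟨2, by omega, by omega, add_comm _ _⟩))
    · refine Or.inr (hadj _ _ ((r - 1) • b) b hqb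
        (hendmem.2 ⟨r - 1, by omega, by omega, by simpa using hmem (r - 1) 0⟩) ?_)
      show (r - 1) • b + b - 0 • b ∈ Z
      rw [← succ_nsmul, Nat.sub_add_cancel (by omega), zero_smul, sub_zero]
      exact hrZ
    · exact Or.inl (hadj _ _ _ a hqa (harcmem.2 ⟨0, by omega, by omega, rfl⟩)
        (harcmem.2 ⟨1, by omega, by omega, by simp⟩))
    · refine Or.inr (hadj _ _ _ a hqa (harcmem.2 ⟨m - 1, by omega, by omega, rfl⟩)
        (harcmem.2 ⟨0, by omega, by omega, ?_⟩))
      rw [add_assoc, ← succ_nsmul, Nat.sub_add_cancel (by omega), hma, zero_smul]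
    · exact Or.inl (hadj _ _ _ b hqb (harcmem.2 ⟨0, by omega, by omega, rfl⟩) (hrow2 _))
    · exact Or.inl (hadj _ _ _ a hqa (harcmem.2 ⟨1, by omega, by omega, rfl⟩)
        (harcmem.2 ⟨2, by omega, by omega, by rw [two_smul, one_smul, add_assoc]⟩))
    · exact Or.inl (hadj _ _ _ b hqb (harcmem.2 ⟨1, by omega, by omega, rfl⟩) (hrow2 _))
    · exact Or.inl (hadj _ _ _ b hqb (harcmem.2 ⟨2, by omega, by omega, rfl⟩) (hrow2 _))
  refine hplanar.1 (SimpleGraph.isMinorOf_of_branchSets (fun i => π ⁻¹' T i) ?_ hTconn ?_)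
  · intro i j v hi hj
    rcases lt_trichotomy i j with h | h | h
    · exact (hTdisj i j h _ hi hj).elim
    · exact h
    · exact (hTdisj j i h _ hj hi).elim
  · have hsymm : ∀ B B' : Set (A ⊕ A), (∃ u ∈ B, ∃ v ∈ B', (haarGraph S).Adj u v) →
        ∃ u ∈ B', ∃ v ∈ B, (haarGraph S).Adj u v :=
      fun _ _ ⟨u, hu, v, hv, h⟩ => ⟨v, hv, u, hu, h.symm⟩
    intro i j hij
    rcases lt_or_gt_of_ne hij.ne with h | h
    · exact (hTadj i j h).elim id (hsymm _ _)
    · exact (hTadj j i h).elim (hsymm _ _) id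

end haarGraph

theorem mem_zmultiples_of_addOrderOf_dvd [AddCommGroup A] [Finite A] [IsAddCyclic A] {x y : A}
    (h : addOrderOf y ∣ addOrderOf x) : y ∈ AddSubgroup.zmultiples x := by
  classical
  cases nonempty_fintype A
  have hsub : (AddSubgroup.zmultiples x : Set A).toFinset ⊆
      Finset.univ.filter fun z : A => addOrderOf x • z = 0 := by
    intro z hz
    obtain ⟨k, rfl⟩ := AddSubgroup.mem_zmultiples_iff.1 (by simpa using hz)
    simp [smul_comm (addOrderOf x) k x, addOrderOf_nsmul_eq_zero]
  have heq := Finset.eq_of_subset_of_card_le hsub <| by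
    refine (IsAddCyclic.card_nsmul_eq_zero_le (addOrderOf_pos x)).trans ?_
    simp [Fintype.card_zmultiples]
  have : y ∈ (AddSubgroup.zmultiples x : Set A).toFinset := by
    rw [heq]
    simpa using addOrderOf_dvd_iff_nsmul_eq_zero.1 h
  simpa using this

theorem addOrderOf_dvd_two_mul_of_two_nsmul_mem_zmultiples [AddCommGroup A] {x y : A}
    (h : 2 • y ∈ AddSubgroup.zmultiples x) : addOrderOf y ∣ 2 * addOrderOf x := by
  rw [addOrderOf_dvd_iff_nsmul_eq_zero, mul_comm, mul_nsmul']
  obtain ⟨k, hk⟩ := AddSubgroup.mem_zmultiples_iff.1 h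
  rw [← hk, smul_comm, addOrderOf_nsmul_eq_zero, smul_zero]

/-- In a cyclic group, the subgroups generated by `x` and `y` are comparable as soon as `2 • x` and
`2 • y` lie in the subgroups generated by `y` and `x`. -/
theorem mem_zmultiples_or_mem_zmultiples_of_two_nsmul [AddCommGroup A] [Finite A] [IsAddCyclic A]
    {x y : A} (hx : 2 • x ∈ AddSubgroup.zmultiples y) (hy : 2 • y ∈ AddSubgroup.zmultiples x) :
    x ∈ AddSubgroup.zmultiples y ∨ y ∈ AddSubgroup.zmultiples x := by
  obtain ⟨u, hu⟩ := addOrderOf_dvd_two_mul_of_two_nsmul_mem_zmultiples hx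
  obtain ⟨v, hv⟩ := addOrderOf_dvd_two_mul_of_two_nsmul_mem_zmultiples hy
  have hxpos := addOrderOf_pos x
  have huv : u * v = 4 := by
    have : addOrderOf x * (u * v) = addOrderOf x * 4 := by
      rw [← mul_assoc, ← hu, mul_assoc, ← hv]; ring
    exact Nat.eq_of_mul_eq_mul_left hxpos this
  have hu4 : u ≤ 4 := Nat.le_of_dvd (by norm_num) ⟨v, huv.symm⟩
  interval_cases u
  · omega
  · exact Or.inr (mem_zmultiples_of_addOrderOf_dvd ⟨2, by omega⟩)
  · exact Or.inl (mem_zmultiples_of_addOrderOf_dvd ⟨1, by omega⟩)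
  · omega
  · exact Or.inl (mem_zmultiples_of_addOrderOf_dvd ⟨2, by omega⟩)

namespace haarGraph

variable [AddCommGroup A] {S : Set A}

theorem midpoint_of_mem_zmultiples [Finite A] (hS : (haarGraph S).Planar) {p u v : A} (hp : p ∈ S)
    (hu : u ∈ S) (hv : v ∈ S) (hpv : p ≠ v) (huv : u ≠ v)
    (h : v - p ∈ AddSubgroup.zmultiples (u - p)) : u + v = p + p ∨ p + v = u + u := by
  classical
  obtain ⟨k, hk, hkv⟩ := Finset.mem_image.1 (mem_zmultiples_iff_mem_range_addOrderOf.1 h)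
  rw [Finset.mem_range] at hk
  have hv' : v = p + k • (u - p) := by rw [hkv]; abel
  by_contra! hne
  have h0 : k ≠ 0 := by rintro rfl; simp at hv'; exact hpv hv'.symm
  have h1 : k ≠ 1 := by rintro rfl; simp at hv'; exact huv hv'.symm
  have h2 : k ≠ 2 := by
    rintro rfl
    apply hne.2
    rw [hv', two_smul]; abel
  have hlast : k + 1 ≠ addOrderOf (u - p) := by
    intro hk'
    apply hne.1
    have := addOrderOf_nsmul_eq_zero (u - p)
    rw [← hk', add_smul, one_smul] at this
    rw [hv', eq_neg_of_add_eq_zero_left this]; abel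
  exact not_planar_of_chords (a := u - p) hp (by simpa using hu) (hv' ▸ hv) (by omega) (by omega) hS

theorem two_nsmul_eq_zero_of_planar [Finite A] [IsAddCyclic A] (hS : (haarGraph S).Planar)
    {p u v : A} (hp : p ∈ S) (hu : u ∈ S) (hv : v ∈ S) (hpu : p ≠ u) (hpv : p ≠ v)
    (h : v - p ∉ AddSubgroup.zmultiples (u - p)) (h' : u - p ∉ AddSubgroup.zmultiples (v - p)) :
    addOrderOf (u - p) = 2 ∨ addOrderOf (v - p) = 2 := by
  have key : ∀ {u v : A}, u ∈ S → v ∈ S → p ≠ u → v - p ∉ AddSubgroup.zmultiples (u - p) →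
      addOrderOf (u - p) ≠ 2 → 2 • (v - p) ∈ AddSubgroup.zmultiples (u - p) := by
    intro u v hu hv hpu h hu2
    by_contra h2
    refine not_planar_of_cosets (a := u - p) (b := v - p) hp (by simpa using hu) (by simpa using hv)
      ?_ h h2 hS
    have := addOrderOf_pos (u - p)
    have : addOrderOf (u - p) ≠ 1 := by
      rw [Ne, AddMonoid.addOrderOf_eq_one_iff, sub_eq_zero]; exact hpu.symm
    omega
  by_contra! hne
  exact (mem_zmultiples_or_mem_zmultiples_of_two_nsmul (key hv hu hpv h' hne.2)
    (key hu hv hpu h hne.1)).elim h' h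

/-- Any three connections of a planar Haar graph over a cyclic group are in arithmetic
progression. -/
theorem exists_midpoint [Finite A] [IsAddCyclic A] (hS : (haarGraph S).Planar) {p u v : A}
    (hp : p ∈ S) (hu : u ∈ S) (hv : v ∈ S) (hpu : p ≠ u) (hpv : p ≠ v) (huv : u ≠ v) :
    u + v = p + p ∨ p + v = u + u ∨ p + u = v + v := by
  by_contra! hne
  obtain ⟨h1, h2, h3⟩ := hne
  have hmem : ∀ {p u v : A}, p ∈ S → u ∈ S → v ∈ S → p ≠ v → u ≠ v → u + v ≠ p + p →
      p + v ≠ u + u → v - p ∉ AddSubgroup.zmultiples (u - p) := by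
    intro p u v hp hu hv hpv huv h1 h2 h
    exact (midpoint_of_mem_zmultiples hS hp hu hv hpv huv h).elim h1 h2
  have horder : ∀ {p u v : A}, v - p ∉ AddSubgroup.zmultiples (u - p) →
      addOrderOf (u - p) = 2 → addOrderOf (v - p) = 2 → False := fun h hu hv =>
    h (mem_zmultiples_of_addOrderOf_dvd (by rw [hu, hv]))
  have hp1 := hmem hp hu hv hpv huv h1 h2
  have hp2 := hmem hp hv hu hpu huv.symm (by rwa [add_comm]) h3
  have hu1 := hmem hu hp hv huv hpv h2 h1
  have hu2 := hmem hu hv hp hpu.symm hpv.symm (by rwa [add_comm]) (by rwa [add_comm])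
  have hv1 := hmem hv hp hu huv.symm hpu h3 (by rwa [add_comm])
  have hv2 := hmem hv hu hp hpv.symm hpu.symm (by rwa [add_comm]) (by rwa [add_comm])
  have hsymm : ∀ x y : A, addOrderOf (x - y) = addOrderOf (y - x) := fun x y => by
    rw [← neg_sub, addOrderOf_neg]
  have := two_nsmul_eq_zero_of_planar hS hp hu hv hpu hpv hp1 hp2
  have := two_nsmul_eq_zero_of_planar hS hu hp hv hpu.symm huv hu1 hu2
  have := two_nsmul_eq_zero_of_planar hS hv hp hu hpv.symm huv.symm hv1 hv2
  have := horder hp1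
  have := horder hu1
  have := horder hv1
  rw [hsymm p u, hsymm p v, hsymm u v] at *
  tauto

theorem even_addOrderOf_of_midpoint [Finite A] (hS : (haarGraph S).Planar) {q u v : A}
    (hq : q ∈ S) (hu : u ∈ S) (hv : v ∈ S) (hqu : q ≠ u) (huv : u ≠ v) (h : u + v = q + q) :
    Even (addOrderOf (u - q)) := by
  obtain ⟨s, rfl⟩ : ∃ s, u = q + s := ⟨u - q, by abel⟩
  obtain rfl : v = q - s := by
    rw [← add_left_cancel_iff (a := q + s), h]; abel
  rw [add_sub_cancel_left]
  by_contra! hodd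
  rw [Nat.not_even_iff_odd] at hodd
  have hs : s ≠ 0 := by rintro rfl; simp at hqu
  have h2s : s + s ≠ 0 := by
    intro h0
    apply huv
    rw [eq_sub_iff_add_eq, add_assoc, h0, add_zero]
  have hm1 : addOrderOf s ≠ 1 := by rwa [Ne, AddMonoid.addOrderOf_eq_one_iff]
  obtain ⟨k, hk⟩ := hodd
  have hzero := addOrderOf_nsmul_eq_zero s
  rcases (show k = 1 ∨ 2 ≤ k by omega) with rfl | hk2
  · rw [hk] at hzero
    have h3 : s + s + s = 0 := by rw [← hzero]; norm_num [succ_nsmul]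
    refine not_planar_of_progression hs h2s hq hu ?_ hv ?_ hS
    · rw [show q + s + s = q - s by grind]
      exact hv
    · rw [show q - s - s = q + s by grind]
      exact hu
  · refine not_planar_of_chords (q := q - s) (a := 2 • s) (k := k + 1) hv ?_ ?_ (by omega) ?_ hS
    · convert hu using 1
      rw [two_smul]; abel
    · convert hq using 1
      rw [← mul_smul, show (k + 1) * 2 = 2 * k + 1 + 1 by ring, ← hk, add_smul, hzero]
      simp
    · rw [Nat.Coprime.addOrderOf_nsmul (by rw [hk]; simp)]
      omega

theorem not_planar_of_midpoint_of_mem [Finite A] [IsAddCyclic A] {q u v z : A} (hq : q ∈ S)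
    (hu : u ∈ S) (hv : v ∈ S) (hz : z ∈ S) (hqu : q ≠ u) (hqv : q ≠ v) (hqz : q ≠ z) (huv : u ≠ v)
    (huz : u ≠ z) (hvz : v ≠ z) (h : u + v = q + q) : ¬ (haarGraph S).Planar := by
  intro hS
  have heven := even_addOrderOf_of_midpoint hS hq hu hv hqu huv h
  have hz1 := exists_midpoint hS hq hu hz hqu hqz huz
  have hz2 := exists_midpoint hS hq hv hz hqv hqz hvz
  obtain ⟨s, rfl⟩ : ∃ s, u = q + s := ⟨u - q, by abel⟩
  obtain rfl : v = q - s := by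
    rw [← add_left_cancel_iff (a := q + s), h]; abel
  obtain ⟨y, rfl⟩ : ∃ y, z = q + y := ⟨z - q, by abel⟩
  rw [add_sub_cancel_left] at heven
  have h2s : s + s ≠ 0 := by
    intro h0
    apply huv
    rw [eq_sub_iff_add_eq, add_assoc, h0, add_zero]
  have hs : s ≠ 0 := by rintro rfl; simp at hqu
  have h5 : (5 : ℕ) • s ≠ 0 := fun h0 =>
    absurd (heven.two_dvd.trans (addOrderOf_dvd_iff_nsmul_eq_zero.2 h0)) (by decide)
  have hz1' : y = s + s ∨ y + y = s := by grind
  have hz2' : y = -s - s ∨ y + y = -s := by grind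
  have h5' : s + s + s + s + s ≠ 0 := by simpa [succ_nsmul] using h5
  rcases hz1' with rfl | h1
  · rcases hz2' with h2 | h2
    · refine not_planar_of_progression hs h2s hq hu (by rwa [add_assoc]) hv ?_ hS
      rw [show q - s - s = q + (s + s) by grind]
      exact hz
    · grind
  · grind

end haarGraph

namespace haarGraph

theorem zmultiples_eq_top_iff {n : ℕ} [NeZero n] (s : ℕ) :
    AddSubgroup.zmultiples (s : ZMod n) = ⊤ ↔ Nat.gcd n s = 1 := by
  rw [← AddSubgroup.card_eq_iff_eq_top, Nat.card_zmultiples, Nat.card_zmod,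
    ZMod.addOrderOf_coe s (NeZero.ne n), Nat.div_eq_self]
  simp [NeZero.ne n]

/-- The nonempty connection sets of connected planar Haar graphs over a finite cyclic group of
order at least five. -/
theorem exists_eq_of_connected_of_planar [AddCommGroup A] [Finite A] [IsAddCyclic A] [DecidableEq A]
    (hA : 2 ≤ Nat.card A) {S : Finset A} (hne : S.Nonempty) (hconn : (haarGraph (S : Set A)).Connected)
    (hS : (haarGraph (S : Set A)).Planar) :
    ∃ q s : A, AddSubgroup.zmultiples s = ⊤ ∧
      (S = {q, q + s} ∨ (Even (addOrderOf s) ∧ S = {q, q + s, q - s})) := by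
  obtain ⟨q, hq⟩ := hne
  rcases (S.erase q).eq_empty_or_nonempty with h0 | ⟨u, hu⟩
  · have hbot := eq_top_of_connected hconn q ⊥ fun p hp => by
      by_contra hpq
      have : p ∈ S.erase q := Finset.mem_erase.2 ⟨by rintro rfl; simp at hpq, hp⟩
      simp [h0] at this
    rw [← AddSubgroup.card_eq_iff_eq_top, AddSubgroup.card_bot] at hbot
    omega
  obtain ⟨huq, huS⟩ := Finset.mem_erase.1 hu
  rcases ((S.erase q).erase u).eq_empty_or_nonempty with h0 | ⟨v, hv⟩
  · have hSeq : S = {q, u} := by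
      rw [← Finset.insert_erase hq, ← Finset.insert_erase hu, h0, insert_empty_eq]
    refine ⟨q, u - q, eq_top_of_connected hconn q _ fun p hp => ?_, Or.inl (by simpa using hSeq)⟩
    rw [hSeq] at hp
    rcases (by simpa using hp : p = q ∨ p = u) with rfl | rfl
    · simp
    · exact AddSubgroup.mem_zmultiples _
  obtain ⟨hvu, hvq, hvS⟩ : v ≠ u ∧ v ≠ q ∧ v ∈ S := by simpa using hv
  obtain ⟨p, x, y, hp, hx, hy, hpx, hpy, hxy, h⟩ : ∃ p x y, p ∈ S ∧ x ∈ S ∧ y ∈ S ∧ p ≠ x ∧ p ≠ y ∧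
      x ≠ y ∧ x + y = p + p := by
    rcases exists_midpoint hS hq huS hvS huq.symm hvq.symm hvu.symm with h | h | h
    · exact ⟨q, u, v, hq, huS, hvS, huq.symm, hvq.symm, hvu.symm, h⟩
    · exact ⟨u, q, v, huS, hq, hvS, huq, hvu.symm, hvq.symm, h⟩
    · exact ⟨v, q, u, hvS, hq, huS, hvq, hvu, huq.symm, h⟩
  have hSeq : S = {p, x, y} := by
    refine Finset.Subset.antisymm (fun z hz => ?_) (by grind)
    by_contra hz'
    obtain ⟨h1, h2, h3⟩ : z ≠ p ∧ z ≠ x ∧ z ≠ y := by simpa using hz'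
    exact not_planar_of_midpoint_of_mem hp hx hy hz hpx hpy h1.symm hxy h2.symm h3.symm h hS
  have hyeq : y = p - (x - p) := by grind
  refine ⟨p, x - p, eq_top_of_connected hconn p _ fun z hz => ?_,
    Or.inr ⟨even_addOrderOf_of_midpoint hS hp hx hy hpx hxy h, ?_⟩⟩
  · rw [hSeq] at hz
    rcases (by simpa using hz : z = p ∨ z = x ∨ z = y) with rfl | rfl | rfl
    · simp
    · exact AddSubgroup.mem_zmultiples _
    · rw [hyeq, sub_sub_cancel_left]
      exact neg_mem (AddSubgroup.mem_zmultiples _)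
  · rw [← hyeq, add_sub_cancel]
    exact hSeq

end haarGraph

theorem stmt15 (n : ℕ) (hn : 5 ≤ n) (Q : Finset ℕ)
    (hQ : Q ⊆ Finset.range n) (hQne : Q.Nonempty) :
    ((Gamma n ∅ ∅ Q).Connected ∧ (Gamma n ∅ ∅ Q).Planar) ↔
    ((∃ q s : ℕ, Nat.gcd n s = 1 ∧
        Q.image (fun x : ℕ => (x : ZMod n)) = {(q : ZMod n), (q : ZMod n) + (s : ZMod n)}) ∨
     (∃ q s : ℕ, Even n ∧ Nat.gcd n s = 1 ∧
        Q.image (fun x : ℕ => (x : ZMod n)) =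
          {(q : ZMod n), (q : ZMod n) + (s : ZMod n), (q : ZMod n) - (s : ZMod n)})) := by
  have : NeZero n := ⟨by omega⟩
  rw [Gamma_empty_eq_haarGraph]
  constructor
  · rintro ⟨hconn, hplanar⟩
    obtain ⟨q, s, hs, h⟩ := haarGraph.exists_eq_of_connected_of_planar
      (by rw [Nat.card_zmod]; omega) (hQne.image _) hconn hplanar
    have hgcd : Nat.gcd n s.val = 1 := by
      rwa [← haarGraph.zmultiples_eq_top_iff, ZMod.natCast_zmod_val]
    rcases h with h | ⟨heven, h⟩
    · exact Or.inl ⟨q.val, s.val, hgcd, by simpa only [ZMod.natCast_zmod_val] using h⟩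
    · refine Or.inr ⟨q.val, s.val, ?_, hgcd, by simpa only [ZMod.natCast_zmod_val] using h⟩
      rwa [← Nat.card_zmultiples, hs, AddSubgroup.card_top, Nat.card_zmod] at heven
  · rintro (⟨q, s, hgcd, h⟩ | ⟨q, s, heven, hgcd, h⟩)
    · rw [h]
      have hs := (haarGraph.zmultiples_eq_top_iff (n := n) s).2 hgcd
      refine ⟨haarGraph.connected (q := (q : ZMod n)) (by simp) (by simp) hs, ?_⟩
      simpa using haarGraph.planar_pair hs
    · rw [h]
      have hs := (haarGraph.zmultiples_eq_top_iff (n := n) s).2 hgcd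
      refine ⟨haarGraph.connected (q := (q : ZMod n)) (by simp) (by simp) hs, ?_⟩
      have hodd : Odd s := by
        rw [← Nat.not_even_iff_odd]
        intro hs2
        have := Nat.dvd_gcd heven.two_dvd hs2.two_dvd
        omega
      simpa using haarGraph.planar_prism hs (ZMod.castHom heven.two_dvd (ZMod 2)).toAddMonoidHom
        (by simpa using (ZMod.natCast_eq_one_iff_odd (n := s)).2 hodd)
end
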